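/- Let μ ∝ e^{−f} on ℝ^d with f three times continuously differentiable, L-smooth, e^{−f} subexponential-tailed, sup_x tr(∇²f_x) ≤ Υ, and with finite uniform third-derivative norms ‖∇³f_·‖_{{1,2,3}} := sup_x ‖∇³f_x‖_{{1,2,3}} and ‖∇³f_·‖_{{1,2}{3}} := sup_x ‖∇³f_x‖_{{1,2}{3}}. For (𝔮_0, 𝔭_0) ~ μ × N(0, I_d) let (𝔮_t, 𝔭_t) be the continuous Hamiltonian dynamics at time t ≥ 0 (which exists since ∇f is Lipschitz). There is a universal constant c > 0 such that for every integer ℓ ≥ 1, with Υ_ℓ := Υ + 2(ℓ−1)L: ( E | 𝔭_tᵀ ∇²f_{𝔮_t} 𝔭_t − 𝔭_0ᵀ ∇²f_{𝔮_0} 𝔭_0 |^ℓ )^{1/ℓ} ≤ c t ( ℓ^{1/2} L Υ_ℓ^{1/2} + ℓ^{3/2} ‖∇³f_·‖_{{1,2,3}} + ℓ^{1/2} d^{1/2} ‖∇³f_·‖_{{1,2}{3}} ). -/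

import Mathlib

open MeasureTheory Real
open scoped ENNReal NNReal

noncomputable section

/-- The Euclidean space `ℝ^d`. -/
abbrev Euc (d : ℕ) := EuclideanSpace ℝ (Fin d)

/-- `leapfrog f η k (q₀,p₀)` is the `k`-th leapfrog iterate with step size `η` for the
potential `f`, starting at `(q₀,p₀)`. -/
def leapfrog {d : ℕ} (f : Euc d → ℝ) (η : ℝ) : ℕ → Euc d × Euc d → Euc d × Euc d
  | 0, z => z
  | (k+1), z =>
      let w := leapfrog f η k z
      let q' := w.1 + η • w.2 - (η^2/2) • gradient f w.1
      (q', w.2 - (η/2) • gradient f w.1 - (η/2) • gradient f q')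

/-- `f` is `L`-smooth: the Hessian has operator norm at most `L` everywhere. -/
def LSmooth {d : ℕ} (f : Euc d → ℝ) (L : ℝ) : Prop :=
  ∀ x, ‖fderiv ℝ (gradient f) x‖ ≤ L

/-- The entries of the third-derivative tensor of `f` at `x`. -/
def tensor3 {ι : Type*} [Fintype ι] [DecidableEq ι]
    (f : EuclideanSpace ℝ ι → ℝ) (x : EuclideanSpace ℝ ι) (i j k : ι) : ℝ :=
  iteratedFDeriv ℝ 3 f x
    ![EuclideanSpace.single i 1, EuclideanSpace.single j 1, EuclideanSpace.single k 1]

/-- The `{1,2,3}`-norm (Frobenius norm) of a 3-tensor. -/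
def norm123 {ι : Type*} [Fintype ι] (A : ι → ι → ι → ℝ) : ℝ :=
  Real.sqrt (∑ i, ∑ j, ∑ k, (A i j k)^2)

/-- The `{1,2}{3}`-norm of a 3-tensor. -/
def norm12_3 {ι : Type*} [Fintype ι] (A : ι → ι → ι → ℝ) : ℝ :=
  sSup { s | ∃ (X : ι → ι → ℝ) (y : ι → ℝ), (∑ i, ∑ j, (X i j)^2) ≤ 1 ∧
    (∑ k, (y k)^2) ≤ 1 ∧ s = ∑ i, ∑ j, ∑ k, A i j k * X i j * y k }

/-- `f` is `γ L^{3/2}`-strongly Hessian Lipschitz. -/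
def StronglyHessLip {d : ℕ} (f : Euc d → ℝ) (γ L : ℝ) : Prop :=
  ∀ x, norm12_3 (tensor3 f x) ≤ γ * L ^ ((3:ℝ)/2)

/-- Distance between two sets. -/
def setDistance {α : Type*} [PseudoMetricSpace α] (S T : Set α) : ℝ :=
  sInf { r | ∃ x ∈ S, ∃ y ∈ T, r = dist x y }

/-- Cheeger isoperimetric inequality with coefficient `ψ`. -/
def CheegerIso {d : ℕ} (μ : Measure (Euc d)) (ψ : ℝ) : Prop :=
  ∀ S1 S2 S3 : Set (Euc d), MeasurableSet S1 → MeasurableSet S2 → MeasurableSet S3 →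
    Disjoint S1 S2 → Disjoint S1 S3 → Disjoint S2 S3 → S1 ∪ S2 ∪ S3 = Set.univ →
    ψ * setDistance S1 S2 * (μ S1).toReal * (μ S2).toReal ≤ (μ S3).toReal

/-- The probability measure proportional to `e^{-f}`. -/
def targetMeasure {d : ℕ} (f : Euc d → ℝ) : Measure (Euc d) :=
  ((volume.withDensity fun x => ENNReal.ofReal (Real.exp (-f x))) Set.univ)⁻¹ •
    (volume.withDensity fun x => ENNReal.ofReal (Real.exp (-f x)))

/-- The standard Gaussian measure `N(0, I_d)` on `ℝ^d`. -/
def stdGaussian (d : ℕ) : Measure (Euc d) :=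
  Measure.map (⇑(EuclideanSpace.equiv (Fin d) ℝ).symm)
    (Measure.pi fun _ : Fin d => ProbabilityTheory.gaussianReal 0 1)

/-- Metropolis acceptance probability of the HMC proposal. -/
def accProb {d : ℕ} (f : Euc d → ℝ) (K : ℕ) (η : ℝ) (q p : Euc d) : ℝ :=
  min 1 (Real.exp (-(f (leapfrog f η K (q,p)).1) - ‖(leapfrog f η K (q,p)).2‖^2/2
    + f q + ‖p‖^2/2))

/-- One step of Metropolized HMC with `K` leapfrog steps and step size `η`, from `q`. -/
def hmcKernel {d : ℕ} (f : Euc d → ℝ) (K : ℕ) (η : ℝ) (q : Euc d) : Measure (Euc d) :=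
  (stdGaussian d).bind fun p =>
    ENNReal.ofReal (accProb f K η q p) • Measure.dirac (leapfrog f η K (q,p)).1 +
    ENNReal.ofReal (1 - accProb f K η q p) • Measure.dirac q

/-- One step of the lazy version of Metropolized HMC. -/
def lazyHMC {d : ℕ} (f : Euc d → ℝ) (K : ℕ) (η : ℝ) (q : Euc d) : Measure (Euc d) :=
  (2:ℝ≥0∞)⁻¹ • Measure.dirac q + (2:ℝ≥0∞)⁻¹ • hmcKernel f K η q

/-- The law of the lazy Metropolized HMC chain after `n` steps started from `μ₀`. -/
def hmcIter {d : ℕ} (f : Euc d → ℝ) (K : ℕ) (η : ℝ) (μ0 : Measure (Euc d)) :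
    ℕ → Measure (Euc d)
  | 0 => μ0
  | (n+1) => (hmcIter f K η μ0 n).bind (lazyHMC f K η)

/-- Total variation distance between two measures. -/
def tvDist {α : Type*} [MeasurableSpace α] (P Q : Measure α) : ℝ :=
  sSup { r | ∃ A, MeasurableSet A ∧ r = |(P A).toReal - (Q A).toReal| }

/-- `ε`-mixing time of lazy Metropolized HMC started from `μ₀`, targetting `μ ∝ e^{-f}`. -/
def mixingTime {d : ℕ} (f : Euc d → ℝ) (K : ℕ) (η : ℝ) (μ0 : Measure (Euc d)) (ε : ℝ) : ℕ :=
  sInf { n : ℕ | tvDist (hmcIter f K η μ0 n) (targetMeasure f) ≤ ε }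

/-- `μ₀` is `M`-warm with respect to `μ`. -/
def Warm {α : Type*} [MeasurableSpace α] (μ0 μ : Measure α) (M : ℝ) : Prop :=
  ∀ S : Set α, MeasurableSet S → μ0 S ≤ ENNReal.ofReal M * μ S

/-- `e^{-f}` has subexponential tail. -/
def SubexpTail {d : ℕ} (f : Euc d → ℝ) : Prop :=
  ∃ lam > (0:ℝ), Filter.Tendsto (fun x : Euc d => Real.exp (lam * ‖x‖) * Real.exp (-f x))
    (Bornology.cobounded _) (nhds 0)

end

open scoped RealInnerProductSpace

section GaussianMoments

lemma stdGaussian_eq_mathlib (d : ℕ) :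
    stdGaussian d = ProbabilityTheory.stdGaussian (Euc d) :=
  ProbabilityTheory.map_pi_eq_stdGaussian

instance isProbabilityMeasure_stdGaussian (d : ℕ) : IsProbabilityMeasure (stdGaussian d) := by
  rw [stdGaussian_eq_mathlib]; infer_instance

instance isGaussian_stdGaussian (d : ℕ) : ProbabilityTheory.IsGaussian (stdGaussian d) := by
  rw [stdGaussian_eq_mathlib]; infer_instance

lemma measurePreserving_neg_stdGaussian (d : ℕ) :
    MeasurePreserving (fun x : Euc d => -x) (stdGaussian d) (stdGaussian d) := by
  refine ⟨measurable_neg, ?_⟩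
  rw [stdGaussian_eq_mathlib]
  exact ProbabilityTheory.stdGaussian_map (LinearIsometryEquiv.neg ℝ (E := Euc d))

/-- Rotation by `π/4` preserves the product of two standard Gaussians. -/
lemma measurePreserving_rotation_stdGaussian (d : ℕ) :
    MeasurePreserving
      (fun z : Euc d × Euc d => ((√2 / 2) • (z.1 + z.2), (√2 / 2) • (z.2 - z.1)))
      ((stdGaussian d).prod (stdGaussian d)) ((stdGaussian d).prod (stdGaussian d)) := by
  refine ⟨by fun_prop, ?_⟩
  have h := ProbabilityTheory.IsGaussian.map_rotation_eq_self (μ := stdGaussian d)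
    (by rw [stdGaussian_eq_mathlib]; exact ProbabilityTheory.integral_id_stdGaussian)
    (Real.pi / 4)
  convert h using 2
  ext z : 1
  rw [ContinuousLinearMap.rotation_apply, Real.cos_pi_div_four, Real.sin_pi_div_four]
  ext1
  · simp
  · simp [smul_sub]; abel

lemma integral_coord_mul_coord_stdGaussian (d : ℕ) (i j : Fin d) :
    ∫ x, x i * x j ∂(stdGaussian d) = if i = j then 1 else 0 := by
  have h := ProbabilityTheory.covarianceBilin_apply (μ := stdGaussian d)
    ProbabilityTheory.IsGaussian.memLp_two_id (EuclideanSpace.single i 1)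
    (EuclideanSpace.single j 1)
  rw [stdGaussian_eq_mathlib, ProbabilityTheory.covarianceBilin_stdGaussian] at h
  have h0 : ∫ x, id x ∂(ProbabilityTheory.stdGaussian (Euc d)) = 0 :=
    ProbabilityTheory.integral_id_stdGaussian
  simp only [h0, sub_zero] at h
  rw [stdGaussian_eq_mathlib]
  simp only [EuclideanSpace.inner_single_left, map_one, one_mul] at h
  rw [← h]
  change inner ℝ (EuclideanSpace.single i (1 : ℝ)) (EuclideanSpace.single j (1 : ℝ)) = _
  simp [EuclideanSpace.inner_single_left]

/-- Even moments of a centred real Gaussian. -/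
lemma lintegral_pow_gaussianReal_le (ℓ : ℕ) (hℓ : 1 ≤ ℓ) (s : ℝ) (hs : 0 ≤ s) :
    ∫⁻ x, ‖x‖ₑ ^ (2 * ℓ) ∂(ProbabilityTheory.gaussianReal 0 (s ^ 2).toNNReal)
      ≤ ENNReal.ofReal ((5 * √ℓ * s) ^ (2 * ℓ)) := by
  rcases hs.eq_or_lt with rfl | hs
  · simp [lintegral_dirac]
  set ν := ProbabilityTheory.gaussianReal 0 (s ^ 2).toNNReal
  have hℓ' : (0 : ℝ) < ℓ := by exact_mod_cast hℓ
  set lam : ℝ := √(2 * ℓ) / s with hlam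
  have hlam0 : 0 < lam := by positivity
  have hmgf : ∀ t : ℝ, ∫ x, Real.exp (t * x) ∂ν = Real.exp (s ^ 2 * t ^ 2 / 2) := by
    intro t
    have := congrFun (ProbabilityTheory.mgf_id_gaussianReal (μ := 0) (v := (s ^ 2).toNNReal)) t
    simpa [ProbabilityTheory.mgf, Real.coe_toNNReal _ (sq_nonneg s)] using this
  have hint : ∀ t : ℝ, Integrable (fun x => Real.exp (t * x)) ν := fun t =>
    ProbabilityTheory.integrable_exp_mul_gaussianReal t
  have hpt : ∀ x : ℝ, |x| ^ (2 * ℓ) ≤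
      ((2 * ℓ).factorial / lam ^ (2 * ℓ)) * (Real.exp (lam * x) + Real.exp (-lam * x)) := by
    intro x
    have h1 := Real.pow_div_factorial_le_exp (lam * |x|) (by positivity) (2 * ℓ)
    have h2 : Real.exp (lam * |x|) ≤ Real.exp (lam * x) + Real.exp (-lam * x) := by
      rcases abs_cases x with ⟨h, _⟩ | ⟨h, _⟩ <;> rw [h]
      · linarith [Real.exp_pos (-lam * x)]
      · rw [mul_neg, ← neg_mul]; linarith [Real.exp_pos (lam * x)]
    have h3 := h1.trans h2
    rw [mul_pow, div_le_iff₀ (by positivity)] at h3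
    rw [div_mul_eq_mul_div, le_div_iff₀ (by positivity)]
    linarith
  have hbound : ∫ x, ((2 * ℓ).factorial / lam ^ (2 * ℓ)) *
      (Real.exp (lam * x) + Real.exp (-lam * x)) ∂ν ≤ (5 * √ℓ * s) ^ (2 * ℓ) := by
    rw [integral_const_mul, integral_add (hint _) (hint _), hmgf, hmgf]
    have e1 : s ^ 2 * lam ^ 2 / 2 = ℓ := by
      rw [hlam, div_pow, Real.sq_sqrt (by positivity)]; field_simp
    have e2 : s ^ 2 * (-lam) ^ 2 / 2 = ℓ := by rw [neg_sq, e1]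
    have e3 : lam ^ (2 * ℓ) = (2 * ℓ : ℝ) ^ ℓ / s ^ (2 * ℓ) := by
      rw [hlam, div_pow]
      congr 1
      rw [pow_mul, Real.sq_sqrt (by positivity)]
    have e4 : ((2 * ℓ).factorial : ℝ) ≤ (2 * ℓ : ℝ) ^ (2 * ℓ) := by
      exact_mod_cast Nat.factorial_le_pow (2 * ℓ)
    have e5 : Real.exp ℓ ≤ 3 ^ ℓ := by
      rw [← Real.exp_one_pow]
      exact pow_le_pow_left₀ (Real.exp_pos _).le (Real.exp_one_lt_d9.le.trans (by norm_num)) _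
    have e6 : (5 * √ℓ * s) ^ (2 * ℓ) = (25 * ℓ : ℝ) ^ ℓ * s ^ (2 * ℓ) := by
      rw [mul_pow, pow_mul (5 * √(ℓ : ℝ)), mul_pow 5, Real.sq_sqrt (by positivity)]; norm_num
    rw [e1, e2, e3, e6, ← two_mul]
    have e7 : (2 : ℝ) ≤ 2 ^ ℓ := by
      calc (2 : ℝ) = 2 ^ 1 := by norm_num
        _ ≤ 2 ^ ℓ := pow_le_pow_right₀ (by norm_num) hℓ
    calc ((2 * ℓ).factorial : ℝ) / ((2 * ℓ : ℝ) ^ ℓ / s ^ (2 * ℓ)) * (2 * Real.exp ℓ)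
        ≤ (2 * ℓ : ℝ) ^ (2 * ℓ) / ((2 * ℓ : ℝ) ^ ℓ / s ^ (2 * ℓ)) * (2 ^ ℓ * 3 ^ ℓ) := by
          gcongr
      _ = (2 * ℓ : ℝ) ^ ℓ * s ^ (2 * ℓ) * (2 ^ ℓ * 3 ^ ℓ) := by
          rw [two_mul ℓ, pow_add (2 * (ℓ : ℝ))]; field_simp
      _ = (12 * ℓ : ℝ) ^ ℓ * s ^ (2 * ℓ) := by
          rw [mul_right_comm, ← mul_pow, ← mul_pow]; ring_nf
      _ ≤ _ := by gcongr; norm_num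
  calc ∫⁻ x, ‖x‖ₑ ^ (2 * ℓ) ∂ν
      ≤ ∫⁻ x, ENNReal.ofReal (((2 * ℓ).factorial / lam ^ (2 * ℓ)) *
          (Real.exp (lam * x) + Real.exp (-lam * x))) ∂ν := by
        refine lintegral_mono fun x => ?_
        rw [← ofReal_norm, ← ENNReal.ofReal_pow (norm_nonneg _), Real.norm_eq_abs]
        exact ENNReal.ofReal_le_ofReal (hpt x)
    _ = ENNReal.ofReal (∫ x, ((2 * ℓ).factorial / lam ^ (2 * ℓ)) *
          (Real.exp (lam * x) + Real.exp (-lam * x)) ∂ν) := by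
        rw [ofReal_integral_eq_lintegral_ofReal]
        · exact ((hint _).add (hint _)).const_mul _
        · exact Filter.Eventually.of_forall fun x => by positivity
    _ ≤ _ := ENNReal.ofReal_le_ofReal hbound

lemma eLpNorm_two_mul_nat_le {α E : Type*} [MeasurableSpace α] [NormedAddCommGroup E]
    {μ : Measure α} {ℓ : ℕ} (hℓ : 1 ≤ ℓ) {h : α → E} {C : ℝ≥0∞}
    (H : ∫⁻ x, ‖h x‖ₑ ^ (2 * ℓ) ∂μ ≤ C ^ (2 * ℓ)) :
    eLpNorm h ((2 * ℓ : ℕ) : ℝ≥0∞) μ ≤ C := by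
  have h2 : (2 * ℓ) ≠ 0 := by omega
  rw [eLpNorm_eq_lintegral_rpow_enorm_toReal (by exact_mod_cast h2) (ENNReal.natCast_ne_top _)]
  simp only [ENNReal.toReal_natCast, ENNReal.rpow_natCast]
  calc _ ≤ (C ^ (2 * ℓ)) ^ (1 / ((2 * ℓ : ℕ) : ℝ)) := by gcongr
    _ = C := by
      rw [one_div, ENNReal.pow_rpow_inv_natCast h2]

/-- Linear functionals of a standard Gaussian vector: moment of order `2ℓ`. -/
lemma eLpNorm_inner_stdGaussian_le {d : ℕ} (ℓ : ℕ) (hℓ : 1 ≤ ℓ) (w : Euc d) :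
    eLpNorm (fun y : Euc d => ⟪w, y⟫) ((2 * ℓ : ℕ) : ℝ≥0∞) (stdGaussian d)
      ≤ ENNReal.ofReal (5 * √ℓ) * ‖w‖ₑ := by
  apply eLpNorm_two_mul_nat_le hℓ
  have hmap := ProbabilityTheory.IsGaussian.map_eq_gaussianReal (μ := stdGaussian d)
    (innerSL ℝ w)
  rw [stdGaussian_eq_mathlib, ProbabilityTheory.integral_strongDual_stdGaussian,
    ProbabilityTheory.variance_dual_stdGaussian, ← stdGaussian_eq_mathlib,
    innerSL_apply_norm] at hmap
  have h1 := lintegral_pow_gaussianReal_le ℓ hℓ ‖w‖ (norm_nonneg w)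
  rw [← hmap, lintegral_map (by fun_prop) (by fun_prop)] at h1
  simp only [innerSL_apply_apply] at h1
  refine h1.trans (le_of_eq ?_)
  rw [ENNReal.ofReal_pow (by positivity), ENNReal.ofReal_mul (by positivity),
    ofReal_norm]

end GaussianMoments

section GaussianChaos

/-- Iterated formula for the `L^r` seminorm on a product space. -/
lemma eLpNorm_prod_eq {α β E : Type*} [MeasurableSpace α] [MeasurableSpace β]
    [NormedAddCommGroup E] [MeasurableSpace E] [OpensMeasurableSpace E]
    {μ : Measure α} {ν : Measure β} [SFinite ν] {r : ℝ≥0∞} (h0 : r ≠ 0) (ht : r ≠ ⊤)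
    {h : α × β → E} (hm : Measurable h) :
    eLpNorm h r (μ.prod ν) = eLpNorm (fun x => eLpNorm (fun y => h (x, y)) r ν) r μ := by
  have hr : 0 < r.toReal := ENNReal.toReal_pos h0 ht
  simp only [eLpNorm_eq_lintegral_rpow_enorm_toReal h0 ht, enorm_eq_self]
  rw [lintegral_prod _ (by fun_prop)]
  congr 1
  refine lintegral_congr fun x => ?_
  rw [← ENNReal.rpow_mul, one_div, inv_mul_cancel₀ hr.ne', ENNReal.rpow_one]

/-- If all sections of `h` are dominated in `L^r`, so is `h`. -/
lemma eLpNorm_prod_le_of_forall {α β β' E E' : Type*} [MeasurableSpace α] [MeasurableSpace β]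
    [MeasurableSpace β'] [NormedAddCommGroup E] [MeasurableSpace E] [OpensMeasurableSpace E]
    [NormedAddCommGroup E'] [MeasurableSpace E'] [OpensMeasurableSpace E']
    {μ : Measure α} {ν : Measure β} {ν' : Measure β'} [SFinite ν] [SFinite ν'] {r : ℝ≥0∞}
    (h0 : r ≠ 0) (ht : r ≠ ⊤) {h : α × β → E} {g : α × β' → E'}
    (hm : Measurable h) (gm : Measurable g)
    (H : ∀ x, eLpNorm (fun y => h (x, y)) r ν ≤ eLpNorm (fun y => g (x, y)) r ν') :
    eLpNorm h r (μ.prod ν) ≤ eLpNorm g r (μ.prod ν') := by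
  rw [eLpNorm_prod_eq h0 ht hm, eLpNorm_prod_eq h0 ht gm]
  exact eLpNorm_mono_enorm fun x => by simpa using H x

/-- Conditioning on `ω`, a linear form in an independent Gaussian has controlled moments. -/
lemma eLpNorm_inner_prod_stdGaussian_le {Ω : Type*} [MeasurableSpace Ω] {μ : Measure Ω}
    {d : ℕ} (ℓ : ℕ) (hℓ : 1 ≤ ℓ) {w : Ω → Euc d} (hw : Measurable w) :
    eLpNorm (fun z : Ω × Euc d => ⟪w z.1, z.2⟫) ((2 * ℓ : ℕ) : ℝ≥0∞) (μ.prod (stdGaussian d))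
      ≤ ENNReal.ofReal (5 * √ℓ) * eLpNorm w ((2 * ℓ : ℕ) : ℝ≥0∞) μ := by
  have h0 : ((2 * ℓ : ℕ) : ℝ≥0∞) ≠ 0 := by exact_mod_cast (by omega : 2 * ℓ ≠ 0)
  rw [eLpNorm_prod_eq h0 (ENNReal.natCast_ne_top _) (by fun_prop)]
  have hc : ENNReal.ofReal (5 * √ℓ) = ‖(5 * √ℓ : ℝ)‖ₑ := by
    rw [Real.enorm_eq_ofReal (by positivity)]
  rw [hc, ← eLpNorm_const_smul]
  refine eLpNorm_mono_enorm fun x => ?_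
  rw [enorm_eq_self, Pi.smul_apply, enorm_smul, ← hc]
  exact eLpNorm_inner_stdGaussian_le ℓ hℓ (w x)

lemma eLpNorm_euc_sq_le_sum {Ω : Type*} [MeasurableSpace Ω] {μ : Measure Ω}
    {d : ℕ} (ℓ : ℕ) (hℓ : 1 ≤ ℓ) {w : Ω → Euc d} (hw : Measurable w) :
    eLpNorm w ((2 * ℓ : ℕ) : ℝ≥0∞) μ ^ 2
      ≤ ∑ k, eLpNorm (fun ω => w ω k) ((2 * ℓ : ℕ) : ℝ≥0∞) μ ^ 2 := by
  have key : ∀ {F : Type} [NormedAddCommGroup F] (u : Ω → F),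
      eLpNorm u ((2 * ℓ : ℕ) : ℝ≥0∞) μ ^ 2 = eLpNorm (fun ω => ‖u ω‖ ^ 2) (ℓ : ℝ≥0∞) μ := by
    intro F _ u
    have := eLpNorm_norm_rpow (p := (ℓ : ℝ≥0∞)) (q := 2) (μ := μ) u (by norm_num)
    simp only [Real.rpow_two, ENNReal.rpow_two] at this
    rw [this]
    congr 2
    push_cast
    rw [mul_comm]; norm_num
  simp only [key]
  have : (fun ω => ‖w ω‖ ^ 2) = ∑ k, fun ω => ‖w ω k‖ ^ 2 := by
    ext ω; rw [EuclideanSpace.norm_sq_eq, Finset.sum_apply]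
  rw [this]
  exact eLpNorm_sum_le (fun k _ => by fun_prop) (by exact_mod_cast hℓ)

/-- Moments of a Gaussian linear combination of random variables. -/
lemma eLpNorm_sum_mul_coord_sq_le {Ω : Type*} [MeasurableSpace Ω] {μ : Measure Ω}
    {d : ℕ} (ℓ : ℕ) (hℓ : 1 ≤ ℓ) {h : Fin d → Ω → ℝ} (hh : ∀ k, Measurable (h k)) :
    eLpNorm (fun z : Ω × Euc d => ∑ k, h k z.1 * z.2 k) ((2 * ℓ : ℕ) : ℝ≥0∞)
        (μ.prod (stdGaussian d)) ^ 2
      ≤ ENNReal.ofReal (5 * √ℓ) ^ 2 * ∑ k, eLpNorm (h k) ((2 * ℓ : ℕ) : ℝ≥0∞) μ ^ 2 := by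
  let w : Ω → Euc d := fun ω => WithLp.toLp 2 fun k => h k ω
  have hw : Measurable w := by fun_prop
  have e : (fun z : Ω × Euc d => ∑ k, h k z.1 * z.2 k) = fun z => ⟪w z.1, z.2⟫ := by
    ext z; simp [w, PiLp.inner_apply, mul_comm]
  rw [e]
  calc _ ≤ (ENNReal.ofReal (5 * √ℓ) * eLpNorm w ((2 * ℓ : ℕ) : ℝ≥0∞) μ) ^ 2 := by
        gcongr; exact eLpNorm_inner_prod_stdGaussian_le ℓ hℓ hw
    _ ≤ _ := by
        rw [mul_pow]; gcongr; exact eLpNorm_euc_sq_le_sum ℓ hℓ hw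

/-- The trilinear form of a 3-tensor. -/
def trilin {d : ℕ} (A : Fin d → Fin d → Fin d → ℝ) (x y z : Euc d) : ℝ :=
  ∑ k, (∑ j, (∑ i, A i j k * x i) * y j) * z k

@[fun_prop]
lemma measurable_trilin {d : ℕ} (A : Fin d → Fin d → Fin d → ℝ) {Ω : Type*} [MeasurableSpace Ω]
    {u v w : Ω → Euc d} (hu : Measurable u) (hv : Measurable v) (hw : Measurable w) :
    Measurable (fun ω => trilin A (u ω) (v ω) (w ω)) := by
  unfold trilin; fun_prop

/-- Moments of a decoupled Gaussian chaos of order three. -/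
lemma eLpNorm_trilin_decoupled_le {d : ℕ} (ℓ : ℕ) (hℓ : 1 ≤ ℓ) (A : Fin d → Fin d → Fin d → ℝ) :
    eLpNorm (fun z : (Euc d × Euc d) × Euc d => trilin A z.1.1 z.1.2 z.2)
        ((2 * ℓ : ℕ) : ℝ≥0∞) (((stdGaussian d).prod (stdGaussian d)).prod (stdGaussian d))
      ≤ ENNReal.ofReal (5 * √ℓ) ^ 3 * ENNReal.ofReal (norm123 A) := by
  set M := ENNReal.ofReal (5 * √ℓ)
  set r := ((2 * ℓ : ℕ) : ℝ≥0∞)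
  have h1 : ∀ j k, eLpNorm (fun x : Euc d => ∑ i, A i j k * x i) r (stdGaussian d) ^ 2
      ≤ M ^ 2 * ENNReal.ofReal (∑ i, A i j k ^ 2) := by
    intro j k
    let w : Euc d := WithLp.toLp 2 fun i => A i j k
    have e : (fun x : Euc d => ∑ i, A i j k * x i) = fun x => ⟪w, x⟫ := by
      ext z; simp [w, PiLp.inner_apply, mul_comm]
    have e2 : ENNReal.ofReal (∑ i, A i j k ^ 2) = ‖w‖ₑ ^ 2 := by
      rw [← ofReal_norm, ← ENNReal.ofReal_pow (norm_nonneg _), EuclideanSpace.norm_sq_eq]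
      simp [w]
    rw [e, e2, ← mul_pow]
    gcongr
    exact eLpNorm_inner_stdGaussian_le ℓ hℓ w
  have hsq : eLpNorm (fun z : (Euc d × Euc d) × Euc d => trilin A z.1.1 z.1.2 z.2) r
      (((stdGaussian d).prod (stdGaussian d)).prod (stdGaussian d)) ^ 2
      ≤ (M ^ 3 * ENNReal.ofReal (norm123 A)) ^ 2 := by
    calc _ ≤ M ^ 2 * ∑ k, eLpNorm
          (fun z : Euc d × Euc d => ∑ j, (∑ i, A i j k * z.1 i) * z.2 j) r
          ((stdGaussian d).prod (stdGaussian d)) ^ 2 :=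
          eLpNorm_sum_mul_coord_sq_le ℓ hℓ
            (h := fun k (z : Euc d × Euc d) => ∑ j, (∑ i, A i j k * z.1 i) * z.2 j)
            (fun k => by fun_prop)
      _ ≤ M ^ 2 * ∑ k, M ^ 2 * ∑ j, M ^ 2 * ENNReal.ofReal (∑ i, A i j k ^ 2) := by
          gcongr with k _
          refine (eLpNorm_sum_mul_coord_sq_le ℓ hℓ
            (h := fun j (x : Euc d) => ∑ i, A i j k * x i) (fun j => by fun_prop)).trans ?_
          gcongr with j _
          exact h1 j k
      _ = _ := by
          have hn : ENNReal.ofReal (norm123 A) ^ 2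
              = ∑ k, ∑ j, ENNReal.ofReal (∑ i, A i j k ^ 2) := by
            unfold norm123
            rw [← ENNReal.ofReal_pow (by positivity), Real.sq_sqrt (by positivity)]
            have : ∑ i, ∑ j, ∑ k, A i j k ^ 2 = ∑ k, ∑ j, ∑ i, A i j k ^ 2 := by
              rw [Finset.sum_comm]
              simp_rw [Finset.sum_comm (s := Finset.univ (α := Fin d))
                (f := fun i k => A i _ k ^ 2)]
              rw [Finset.sum_comm]
            rw [this, ENNReal.ofReal_sum_of_nonneg (fun _ _ => by positivity)]
            exact Finset.sum_congr rfl fun k _ =>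
              ENNReal.ofReal_sum_of_nonneg (fun _ _ => by positivity)
          rw [mul_pow, hn]
          simp_rw [← Finset.mul_sum]
          ring
  exact (ENNReal.pow_le_pow_left_iff two_ne_zero).1 hsq

end GaussianChaos

section GaussianDecoupling

/-- Symmetrization: centring decreases to the difference of two independent copies. -/
lemma eLpNorm_sub_integral_le {Ω : Type*} [MeasurableSpace Ω] {μ : Measure Ω}
    [IsProbabilityMeasure μ] {r : ℝ≥0∞} (h1 : 1 ≤ r) (ht : r ≠ ⊤) {u : Ω → ℝ}
    (hu : Measurable u) (hi : Integrable u μ) :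
    eLpNorm (fun x => u x - ∫ y, u y ∂μ) r μ
      ≤ eLpNorm (fun z : Ω × Ω => u z.1 - u z.2) r (μ.prod μ) := by
  rw [eLpNorm_prod_eq (by positivity) ht (by fun_prop)]
  refine eLpNorm_mono_enorm fun x => ?_
  rw [enorm_eq_self]
  have e : u x - ∫ y, u y ∂μ = ∫ y, (u x - u y) ∂μ := by
    rw [integral_sub (integrable_const _) hi]; simp
  calc ‖u x - ∫ y, u y ∂μ‖ₑ = ‖∫ y, (u x - u y) ∂μ‖ₑ := by rw [e]
    _ ≤ ∫⁻ y, ‖u x - u y‖ₑ ∂μ := enorm_integral_le_lintegral_enorm _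
    _ = eLpNorm (fun y => u x - u y) 1 μ := eLpNorm_one_eq_lintegral_enorm.symm
    _ ≤ eLpNorm (fun y => u x - u y) r μ :=
        eLpNorm_le_eLpNorm_of_exponent_le h1 (by fun_prop)

variable {d : ℕ} {A : Fin d → Fin d → Fin d → ℝ}

lemma trilin_add_left (x x' y z : Euc d) :
    trilin A (x + x') y z = trilin A x y z + trilin A x' y z := by
  simp [trilin, mul_add, add_mul, Finset.sum_add_distrib]

lemma trilin_add_mid (x y y' z : Euc d) :
    trilin A x (y + y') z = trilin A x y z + trilin A x y' z := by
  simp [trilin, mul_add, add_mul, Finset.sum_add_distrib]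

lemma trilin_add_right (x y z z' : Euc d) :
    trilin A x y (z + z') = trilin A x y z + trilin A x y z' := by
  simp [trilin, mul_add, Finset.sum_add_distrib]

lemma trilin_smul_left (c : ℝ) (x y z : Euc d) :
    trilin A (c • x) y z = c * trilin A x y z := by
  simp only [trilin, PiLp.smul_apply, smul_eq_mul, Finset.mul_sum, Finset.sum_mul]
  refine Finset.sum_congr rfl fun k _ => Finset.sum_congr rfl fun j _ =>
    Finset.sum_congr rfl fun i _ => by ring

lemma trilin_smul_mid (c : ℝ) (x y z : Euc d) :
    trilin A x (c • y) z = c * trilin A x y z := by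
  simp only [trilin, PiLp.smul_apply, smul_eq_mul, Finset.mul_sum, Finset.sum_mul]
  refine Finset.sum_congr rfl fun k _ => Finset.sum_congr rfl fun j _ =>
    Finset.sum_congr rfl fun i _ => by ring

lemma trilin_smul_right (c : ℝ) (x y z : Euc d) :
    trilin A x y (c • z) = c * trilin A x y z := by
  simp only [trilin, PiLp.smul_apply, smul_eq_mul, Finset.mul_sum]
  refine Finset.sum_congr rfl fun k _ => by ring

lemma trilin_neg_left (x y z : Euc d) : trilin A (-x) y z = -trilin A x y z := by
  simpa using trilin_smul_left (A := A) (-1) x y z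

lemma trilin_neg_mid (x y z : Euc d) : trilin A x (-y) z = -trilin A x y z := by
  simpa using trilin_smul_mid (A := A) (-1) x y z

lemma trilin_neg_right (x y z : Euc d) : trilin A x y (-z) = -trilin A x y z := by
  simpa using trilin_smul_right (A := A) (-1) x y z

lemma trilin_swap_left (h : ∀ i j k, A i j k = A j i k) (x y z : Euc d) :
    trilin A x y z = trilin A y x z := by
  unfold trilin
  refine Finset.sum_congr rfl fun k _ => ?_
  congr 1
  simp_rw [Finset.sum_mul]
  rw [Finset.sum_comm]
  refine Finset.sum_congr rfl fun j _ => Finset.sum_congr rfl fun i _ => ?_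
  rw [h j i k]; ring

lemma trilin_swap_right (h : ∀ i j k, A i j k = A i k j) (x y z : Euc d) :
    trilin A x y z = trilin A x z y := by
  unfold trilin
  simp_rw [Finset.sum_mul]
  rw [Finset.sum_comm]
  refine Finset.sum_congr rfl fun j _ => Finset.sum_congr rfl fun i _ =>
    Finset.sum_congr rfl fun l _ => ?_
  rw [h l j i]; ring

/-- The contraction of a 3-tensor over its first two indices. -/
def contract12 (A : Fin d → Fin d → Fin d → ℝ) : Euc d := WithLp.toLp 2 fun k => ∑ i, A i i k

lemma memLp_coord_stdGaussian (i : Fin d) (r : ℝ≥0∞) (ht : r ≠ ⊤) :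
    MemLp (fun x : Euc d => x i) r (stdGaussian d) := by
  have h := ProbabilityTheory.IsGaussian.memLp_id (stdGaussian d) r ht
  exact h.of_le (by fun_prop) (Filter.Eventually.of_forall fun x => PiLp.norm_apply_le x i)

lemma integrable_coord_mul_coord_stdGaussian (i j : Fin d) :
    Integrable (fun x : Euc d => x i * x j) (stdGaussian d) :=
  (memLp_coord_stdGaussian i 2 (by norm_num)).integrable_mul
    (memLp_coord_stdGaussian j 2 (by norm_num))

lemma trilin_eq_sum (x y z : Euc d) :
    trilin A x y z = ∑ k, ∑ j, ∑ i, A i j k * z k * (x i * y j) := by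
  simp only [trilin, Finset.sum_mul]
  refine Finset.sum_congr rfl fun k _ => Finset.sum_congr rfl fun j _ =>
    Finset.sum_congr rfl fun i _ => by ring

lemma integrable_trilin_diag (z : Euc d) :
    Integrable (fun x => trilin A x x z) (stdGaussian d) := by
  simp_rw [trilin_eq_sum]
  exact integrable_finsetSum _ fun k _ => integrable_finsetSum _ fun j _ =>
    integrable_finsetSum _ fun i _ => (integrable_coord_mul_coord_stdGaussian i j).const_mul _

lemma integral_trilin_diag (z : Euc d) :
    ∫ x, trilin A x x z ∂(stdGaussian d) = ⟪contract12 A, z⟫ := by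
  have hi : ∀ i j k, Integrable (fun x : Euc d => A i j k * z k * (x i * x j)) (stdGaussian d) :=
    fun i j k => (integrable_coord_mul_coord_stdGaussian i j).const_mul _
  simp_rw [trilin_eq_sum]
  rw [integral_finsetSum _ fun k _ => integrable_finsetSum _ fun j _ =>
    integrable_finsetSum _ fun i _ => hi i j k]
  simp only [contract12, PiLp.inner_apply, RCLike.inner_apply, conj_trivial]
  refine Finset.sum_congr rfl fun k _ => ?_
  rw [integral_finsetSum _ fun j _ => integrable_finsetSum _ fun i _ => hi i j k,
    Finset.mul_sum]
  refine Finset.sum_congr rfl fun j _ => ?_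
  rw [integral_finsetSum _ fun i _ => hi i j k]
  simp_rw [integral_const_mul, integral_coord_mul_coord_stdGaussian]
  simp [mul_comm]

variable {ℓ : ℕ}

/-- Decoupling of a centred quadratic Gaussian form. -/
lemma eLpNorm_trilin_diag_sub_le (hℓ : 1 ≤ ℓ) (h12 : ∀ i j k, A i j k = A j i k) (z : Euc d) :
    eLpNorm (fun x => trilin A x x z - ⟪contract12 A, z⟫) ((2 * ℓ : ℕ) : ℝ≥0∞) (stdGaussian d)
      ≤ eLpNorm (fun w : Euc d × Euc d => 2 * trilin A w.1 w.2 z) ((2 * ℓ : ℕ) : ℝ≥0∞)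
        ((stdGaussian d).prod (stdGaussian d)) := by
  rw [← integral_trilin_diag]
  refine (eLpNorm_sub_integral_le (by exact_mod_cast (by omega : 1 ≤ 2 * ℓ))
    (ENNReal.natCast_ne_top _) (by fun_prop) (integrable_trilin_diag z)).trans (le_of_eq ?_)
  rw [← eLpNorm_comp_measurePreserving (by fun_prop) (measurePreserving_rotation_stdGaussian d)]
  congr 1
  ext ⟨x, y⟩
  have hs : √2 * √2 = 2 := Real.mul_self_sqrt (by norm_num)
  simp only [Function.comp, sub_eq_add_neg, trilin_smul_left, trilin_smul_mid, trilin_add_left,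
    trilin_add_mid, trilin_neg_left, trilin_neg_mid]
  rw [trilin_swap_left h12 y x]
  linear_combination (trilin A x y z) * hs

/-- Moments of a partially diagonal Gaussian chaos. -/
lemma eLpNorm_trilin_diag_le (hℓ : 1 ≤ ℓ) (h12 : ∀ i j k, A i j k = A j i k) :
    eLpNorm (fun w : Euc d × Euc d => trilin A w.2 w.2 w.1) ((2 * ℓ : ℕ) : ℝ≥0∞)
        ((stdGaussian d).prod (stdGaussian d))
      ≤ 2 * (ENNReal.ofReal (5 * √ℓ) ^ 3 * ENNReal.ofReal (norm123 A))
        + ENNReal.ofReal (5 * √ℓ) * ‖contract12 A‖ₑ := by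
  have h0 : ((2 * ℓ : ℕ) : ℝ≥0∞) ≠ 0 := by exact_mod_cast (by omega : 2 * ℓ ≠ 0)
  have h1 : 1 ≤ ((2 * ℓ : ℕ) : ℝ≥0∞) := by exact_mod_cast (by omega : 1 ≤ 2 * ℓ)
  have ht : ((2 * ℓ : ℕ) : ℝ≥0∞) ≠ ⊤ := ENNReal.natCast_ne_top _
  have hl := eLpNorm_trilin_decoupled_le ℓ hℓ A
  generalize hr : ((2 * ℓ : ℕ) : ℝ≥0∞) = r at h0 h1 ht hl ⊢
  have hc : eLpNorm (fun w : Euc d × Euc d => trilin A w.2 w.2 w.1 - ⟪contract12 A, w.1⟫) r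
        ((stdGaussian d).prod (stdGaussian d))
      ≤ eLpNorm (fun w : Euc d × (Euc d × Euc d) => (2 : ℝ) * trilin A w.2.1 w.2.2 w.1) r
        ((stdGaussian d).prod ((stdGaussian d).prod (stdGaussian d))) :=
    eLpNorm_prod_le_of_forall
      (h := fun w : Euc d × Euc d => trilin A w.2 w.2 w.1 - ⟪contract12 A, w.1⟫)
      (g := fun w : Euc d × (Euc d × Euc d) => (2 : ℝ) * trilin A w.2.1 w.2.2 w.1)
      h0 ht (by fun_prop) (by fun_prop) fun z => hr ▸ eLpNorm_trilin_diag_sub_le hℓ h12 z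
  have hsw : eLpNorm (fun w : Euc d × (Euc d × Euc d) => (2 : ℝ) * trilin A w.2.1 w.2.2 w.1) r
        ((stdGaussian d).prod ((stdGaussian d).prod (stdGaussian d)))
      = eLpNorm (fun w : (Euc d × Euc d) × Euc d => (2 : ℝ) * trilin A w.1.1 w.1.2 w.2) r
        (((stdGaussian d).prod (stdGaussian d)).prod (stdGaussian d)) :=
    (eLpNorm_comp_measurePreserving
      (g := fun w : Euc d × (Euc d × Euc d) => (2 : ℝ) * trilin A w.2.1 w.2.2 w.1)
      (Measurable.aestronglyMeasurable (by fun_prop))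
      (Measure.measurePreserving_swap (μ := (stdGaussian d).prod (stdGaussian d))
        (ν := stdGaussian d))).symm
  have hfst : eLpNorm (fun w : Euc d × Euc d => ⟪contract12 A, w.1⟫) r
        ((stdGaussian d).prod (stdGaussian d)) ≤ ENNReal.ofReal (5 * √ℓ) * ‖contract12 A‖ₑ :=
    (eLpNorm_comp_measurePreserving (g := fun y : Euc d => ⟪contract12 A, y⟫)
      (by fun_prop) (measurePreserving_fst (μ := stdGaussian d) (ν := stdGaussian d))).le.trans
      (hr ▸ eLpNorm_inner_stdGaussian_le ℓ hℓ _)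
  have e : (fun w : Euc d × Euc d => trilin A w.2 w.2 w.1) =
      (fun w => trilin A w.2 w.2 w.1 - ⟪contract12 A, w.1⟫) + fun w => ⟪contract12 A, w.1⟫ := by
    ext w; simp
  rw [e]
  refine (eLpNorm_add_le (Measurable.aestronglyMeasurable (by fun_prop)) (by fun_prop) h1).trans
    (add_le_add ((hc.trans_eq hsw).trans ?_) hfst)
  have h2 : ‖(2 : ℝ)‖ₑ = 2 := by simp [Real.enorm_eq_ofReal]
  have := eLpNorm_const_smul (2 : ℝ)
    (fun w : (Euc d × Euc d) × Euc d => trilin A w.1.1 w.1.2 w.2) r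
    (((stdGaussian d).prod (stdGaussian d)).prod (stdGaussian d))
  simp only [Pi.smul_def, smul_eq_mul, h2] at this
  rw [this]
  gcongr

lemma eLpNorm_cubic_lt_top (r : ℝ≥0∞) (hr : r ≠ ⊤) :
    eLpNorm (fun x => trilin A x x x) r (stdGaussian d) < ⊤ := by
  suffices h : MemLp (fun x => trilin A x x x) r (stdGaussian d) from h.2
  have h3 := ProbabilityTheory.IsGaussian.memLp_id (stdGaussian d) (r * 3)
    (ENNReal.mul_ne_top hr (by norm_num))
  have hN : MemLp (fun x : Euc d => ‖x‖ ^ 3) r (stdGaussian d) := by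
    refine ⟨by fun_prop, ?_⟩
    have := eLpNorm_norm_rpow (p := r) (q := 3) (μ := stdGaussian d) (fun x : Euc d => x)
      (by norm_num)
    have e3 : ∀ x : Euc d, ‖x‖ ^ (3 : ℝ) = ‖x‖ ^ 3 := fun x => by norm_cast
    simp only [e3, ENNReal.ofReal_ofNat] at this
    rw [this]
    exact ENNReal.rpow_lt_top_of_nonneg (by norm_num) h3.2.ne
  refine (hN.const_mul (∑ k, ∑ j, ∑ i, |A i j k|)).of_le
    (Measurable.aestronglyMeasurable (by fun_prop))
    (Filter.Eventually.of_forall fun x => ?_)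
  rw [Real.norm_of_nonneg (by positivity : 0 ≤ (∑ k, ∑ j, ∑ i, |A i j k|) * ‖x‖ ^ 3),
    trilin_eq_sum]
  simp_rw [Finset.sum_mul]
  refine (norm_sum_le _ _).trans (Finset.sum_le_sum fun k _ => ?_)
  refine (norm_sum_le _ _).trans (Finset.sum_le_sum fun j _ => ?_)
  refine (norm_sum_le _ _).trans (Finset.sum_le_sum fun i _ => ?_)
  rw [norm_mul, norm_mul, norm_mul, Real.norm_eq_abs (A i j k)]
  have := PiLp.norm_apply_le x i
  have := PiLp.norm_apply_le x j
  have := PiLp.norm_apply_le x k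
  calc |A i j k| * ‖x k‖ * (‖x i‖ * ‖x j‖) ≤ |A i j k| * ‖x‖ * (‖x‖ * ‖x‖) := by gcongr
    _ = _ := by ring

lemma integral_cubic_eq_zero : ∫ x, trilin A x x x ∂(stdGaussian d) = 0 := by
  have h := (measurePreserving_neg_stdGaussian d).integral_comp
    (Homeomorph.neg (Euc d)).measurableEmbedding (fun x => trilin A x x x)
  simp only [trilin_neg_left, trilin_neg_mid, trilin_neg_right, neg_neg, integral_neg] at h
  linarith

/-- Moments of a homogeneous cubic form in a standard Gaussian vector. -/
lemma eLpNorm_cubic_le (hℓ : 1 ≤ ℓ) (h12 : ∀ i j k, A i j k = A j i k)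
    (h23 : ∀ i j k, A i j k = A i k j) :
    eLpNorm (fun x => trilin A x x x) ((2 * ℓ : ℕ) : ℝ≥0∞) (stdGaussian d)
      ≤ 8 * (2 * (ENNReal.ofReal (5 * √ℓ) ^ 3 * ENNReal.ofReal (norm123 A))
        + ENNReal.ofReal (5 * √ℓ) * ‖contract12 A‖ₑ) := by
  refine le_trans ?_ (mul_le_mul_right (eLpNorm_trilin_diag_le hℓ h12) 8)
  set r := ((2 * ℓ : ℕ) : ℝ≥0∞)
  set γ := stdGaussian d
  have h1 : 1 ≤ r := by simp only [r]; exact_mod_cast (by omega : 1 ≤ 2 * ℓ)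
  have ht : r ≠ ⊤ := ENNReal.natCast_ne_top _
  set N := eLpNorm (fun x => trilin A x x x) r γ with hN
  set S := eLpNorm (fun w : Euc d × Euc d => trilin A w.2 w.2 w.1) r (γ.prod γ)
  have hNtop : N ≠ ⊤ := (eLpNorm_cubic_lt_top r ht).ne
  have hint : Integrable (fun x => trilin A x x x) γ :=
    memLp_one_iff_integrable.1 ⟨Measurable.aestronglyMeasurable (by fun_prop),
      eLpNorm_cubic_lt_top 1 (by norm_num)⟩
  have hs : √2 * √2 = 2 := Real.mul_self_sqrt (by norm_num)
  have hs1 : √2 ≤ 1.42 := Real.sqrt_le_iff.2 (by norm_num)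
  have key : N ≤ ENNReal.ofReal 0.71 * N + ENNReal.ofReal 2.13 * S := by
    calc N = eLpNorm (fun x => trilin A x x x - ∫ y, trilin A y y y ∂γ) r γ := by
          simp [hN, γ, integral_cubic_eq_zero]
      _ ≤ eLpNorm (fun z : Euc d × Euc d => trilin A z.1 z.1 z.1 - trilin A z.2 z.2 z.2) r
          (γ.prod γ) := eLpNorm_sub_integral_le h1 ht (by fun_prop) hint
      _ = eLpNorm (((√2 / 2) • fun z : Euc d × Euc d => trilin A z.1 z.1 z.1)
          + (3 * √2 / 2) • fun z : Euc d × Euc d => trilin A z.2 z.2 z.1) r (γ.prod γ) := by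
          rw [← eLpNorm_comp_measurePreserving (by fun_prop)
            (measurePreserving_rotation_stdGaussian d)]
          congr 1
          ext ⟨x, y⟩
          have e1 : trilin A x y y = trilin A y y x := by
            rw [trilin_swap_left h12 x y y, trilin_swap_right h23 y x y]
          have e2 : trilin A y x y = trilin A y y x := trilin_swap_right h23 y x y
          have e3 : trilin A x y x = trilin A x x y := trilin_swap_right h23 x y x
          have e4 : trilin A y x x = trilin A x x y := by
            rw [trilin_swap_left h12 y x x, e3]
          simp only [Function.comp, sub_eq_add_neg, trilin_smul_left, trilin_smul_mid,
            trilin_smul_right, trilin_add_left, trilin_add_right, Pi.add_apply, Pi.smul_apply,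
            trilin_add_mid, trilin_neg_left, trilin_neg_mid, trilin_neg_right, e1, e2, e3, e4,
            smul_eq_mul]
          linear_combination (√2 / 4 * trilin A x x x + 3 * √2 / 4 * trilin A y y x) * hs
      _ ≤ ‖√2 / 2‖ₑ * eLpNorm (fun z : Euc d × Euc d => trilin A z.1 z.1 z.1) r (γ.prod γ)
          + ‖3 * √2 / 2‖ₑ * S := by
          refine (eLpNorm_add_le ?_ ?_ h1).trans (le_of_eq ?_)
          · exact (Measurable.aestronglyMeasurable (by fun_prop)).const_smul _
          · exact (Measurable.aestronglyMeasurable (by fun_prop)).const_smul _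
          · rw [eLpNorm_const_smul, eLpNorm_const_smul]
      _ = ‖√2 / 2‖ₑ * N + ‖3 * √2 / 2‖ₑ * S := by
          congr 2
          exact eLpNorm_comp_measurePreserving (g := fun x : Euc d => trilin A x x x)
            (Measurable.aestronglyMeasurable (by fun_prop))
            (measurePreserving_fst (μ := γ) (ν := γ))
      _ ≤ _ := by
          rw [Real.enorm_eq_ofReal (by positivity), Real.enorm_eq_ofReal (by positivity)]
          gcongr <;> linarith
  by_cases hS : S = ⊤
  · simp [hS]
  have k2 := ENNReal.toReal_mono (by finiteness) key
  rw [ENNReal.toReal_add (by finiteness) (by finiteness), ENNReal.toReal_mul, ENNReal.toReal_mul,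
    ENNReal.toReal_ofReal (by norm_num), ENNReal.toReal_ofReal (by norm_num)] at k2
  rw [← ENNReal.toReal_le_toReal hNtop (by finiteness), ENNReal.toReal_mul]
  have := ENNReal.toReal_nonneg (a := S)
  simp only [ENNReal.toReal_ofNat]
  linarith

end GaussianDecoupling

section TensorNorms

variable {d : ℕ} (A : Fin d → Fin d → Fin d → ℝ)

lemma norm123_nonneg : 0 ≤ norm123 A := Real.sqrt_nonneg _

lemma le_norm12_3 {X : Fin d → Fin d → ℝ} {y : Fin d → ℝ} (hX : ∑ i, ∑ j, X i j ^ 2 ≤ 1)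
    (hy : ∑ k, y k ^ 2 ≤ 1) : ∑ i, ∑ j, ∑ k, A i j k * X i j * y k ≤ norm12_3 A := by
  refine le_csSup ⟨∑ i, ∑ j, ∑ k, |A i j k|, ?_⟩ ⟨X, y, hX, hy, rfl⟩
  rintro s ⟨X, y, hX, hy, rfl⟩
  refine Finset.sum_le_sum fun i _ => Finset.sum_le_sum fun j _ => Finset.sum_le_sum fun k _ => ?_
  have h1 : X i j ^ 2 ≤ 1 :=
    (Finset.single_le_sum (f := fun j => X i j ^ 2) (fun _ _ => sq_nonneg _)
      (Finset.mem_univ j)).trans ((Finset.single_le_sum (f := fun i => ∑ j, X i j ^ 2)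
        (fun _ _ => Finset.sum_nonneg fun _ _ => sq_nonneg _) (Finset.mem_univ i)).trans hX)
  have h2 : y k ^ 2 ≤ 1 :=
    (Finset.single_le_sum (f := fun k => y k ^ 2) (fun _ _ => sq_nonneg _)
      (Finset.mem_univ k)).trans hy
  calc A i j k * X i j * y k ≤ |A i j k * X i j * y k| := le_abs_self _
    _ = |A i j k| * |X i j| * |y k| := by rw [abs_mul, abs_mul]
    _ ≤ |A i j k| * 1 * 1 := by
      gcongr
      · exact abs_le_one_iff_mul_self_le_one.2 (by nlinarith)
      · exact abs_le_one_iff_mul_self_le_one.2 (by nlinarith)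
    _ = |A i j k| := by ring

lemma norm12_3_nonneg : 0 ≤ norm12_3 A := by
  simpa using le_norm12_3 A (X := 0) (y := 0) (by simp) (by simp)

lemma norm_contract12_le : ‖contract12 A‖ ≤ √d * norm12_3 A := by
  rcases eq_or_ne (contract12 A) 0 with h0 | h0
  · rw [h0, norm_zero]; exact mul_nonneg (Real.sqrt_nonneg _) (norm12_3_nonneg A)
  have hv : 0 < ‖contract12 A‖ := norm_pos_iff.2 h0
  have hd : 0 < (d : ℝ) := by
    rcases Nat.eq_zero_or_pos d with rfl | h
    · exact absurd (Subsingleton.elim _ _) h0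
    · exact_mod_cast h
  have hs : √(d : ℝ) * √d = d := Real.mul_self_sqrt hd.le
  have hs0 : 0 < √(d : ℝ) := Real.sqrt_pos.2 hd
  have h := le_norm12_3 A (X := fun i j => if i = j then (√d)⁻¹ else 0)
    (y := fun k => contract12 A k / ‖contract12 A‖)
    (by
      simp only [ite_pow, inv_pow, Real.sq_sqrt hd.le]
      simp [hd.ne'])
    (by
      simp only [div_pow, ← Finset.sum_div]
      rw [div_le_one (by positivity), EuclideanSpace.norm_sq_eq]
      simp)
  have e : ∑ i, ∑ j, ∑ k, A i j k * (if i = j then (√(d : ℝ))⁻¹ else 0)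
      * (contract12 A k / ‖contract12 A‖) = (√(d : ℝ))⁻¹ * ‖contract12 A‖ := by
    have e1 : ∀ i, ∑ j, ∑ k, A i j k * (if i = j then (√(d : ℝ))⁻¹ else 0)
        * (contract12 A k / ‖contract12 A‖)
        = ∑ k, A i i k * (√(d : ℝ))⁻¹ * (contract12 A k / ‖contract12 A‖) := by
      intro i
      rw [Finset.sum_eq_single i (fun j _ hj => by simp [hj.symm]) (by simp)]
      simp
    have e2 : ‖contract12 A‖ * ‖contract12 A‖ = ∑ k, contract12 A k * contract12 A k := by
      rw [← pow_two, EuclideanSpace.norm_sq_eq]; simp [pow_two]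
    simp_rw [e1]
    rw [Finset.sum_comm]
    simp_rw [← Finset.sum_mul]
    have e3 : ∀ k, ∑ i, A i i k = contract12 A k := fun k => rfl
    simp_rw [e3]
    rw [← mul_div_cancel_right₀ ((√(d : ℝ))⁻¹ * ‖contract12 A‖) hv.ne', mul_assoc, e2,
      Finset.mul_sum, Finset.sum_div]
    exact Finset.sum_congr rfl fun k _ => by ring
  rw [e, inv_mul_le_iff₀ hs0] at h
  exact h

end TensorNorms

section LipschitzFlow

variable {E : Type*} [NormedAddCommGroup E] [NormedSpace ℝ E] {V : E → E} {K : ℝ≥0}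
  {γ₁ γ₂ γ : ℝ → E}

lemma hasDerivAt_comp_neg_of_trajectory (h : ∀ s, HasDerivAt γ (V (γ s)) s) (s : ℝ) :
    HasDerivAt (fun s => γ (-s)) (-V (γ (-s))) s := by
  simpa [Function.comp_def] using (h (-s)).scomp s (hasDerivAt_neg s)

lemma dist_trajectories_le_of_nonneg (hV : LipschitzWith K V)
    (h₁ : ∀ s, HasDerivAt γ₁ (V (γ₁ s)) s) (h₂ : ∀ s, HasDerivAt γ₂ (V (γ₂ s)) s)
    {s : ℝ} (hs : 0 ≤ s) : dist (γ₁ s) (γ₂ s) ≤ dist (γ₁ 0) (γ₂ 0) * exp (K * s) := by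
  have := dist_le_of_trajectories_ODE (v := fun _ => V) (a := 0) (b := s) (fun _ => hV)
    (fun t _ => (h₁ t).continuousAt.continuousWithinAt) (fun t _ => (h₁ t).hasDerivWithinAt)
    (fun t _ => (h₂ t).continuousAt.continuousWithinAt) (fun t _ => (h₂ t).hasDerivWithinAt)
    le_rfl s ⟨hs, le_rfl⟩
  simpa using this

lemma dist_trajectories_le (hV : LipschitzWith K V)
    (h₁ : ∀ s, HasDerivAt γ₁ (V (γ₁ s)) s) (h₂ : ∀ s, HasDerivAt γ₂ (V (γ₂ s)) s) (s : ℝ) :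
    dist (γ₁ s) (γ₂ s) ≤ dist (γ₁ 0) (γ₂ 0) * exp (K * |s|) := by
  rcases le_total 0 s with hs | hs
  · rw [abs_of_nonneg hs]; exact dist_trajectories_le_of_nonneg hV h₁ h₂ hs
  · have := dist_trajectories_le_of_nonneg (V := fun x => -V x) hV.neg
      (hasDerivAt_comp_neg_of_trajectory h₁) (hasDerivAt_comp_neg_of_trajectory h₂)
      (neg_nonneg.2 hs)
    simpa [abs_of_nonpos hs] using this

lemma dist_trajectory_zero_le_of_nonneg (hV : LipschitzWith K V) (hK : 0 < K)
    (h : ∀ s, HasDerivAt γ (V (γ s)) s) {s : ℝ} (hs : 0 ≤ s) :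
    dist (γ s) (γ 0) ≤ ‖V (γ 0)‖ * s * exp (K * s) := by
  have := dist_le_of_approx_trajectories_ODE (v := fun _ => V) (a := 0) (b := s)
    (g := fun _ => γ 0) (g' := fun _ => 0) (δ := 0) (εf := 0) (εg := ‖V (γ 0)‖) (fun _ => hV)
    (fun t _ => (h t).continuousAt.continuousWithinAt) (fun t _ => (h t).hasDerivWithinAt)
    (fun t _ => by simp) continuousOn_const (fun t _ => hasDerivWithinAt_const _ _ _)
    (fun t _ => by simp) (by simp) s ⟨hs, le_rfl⟩
  have hK' : (0 : ℝ) < K := hK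
  rw [gronwallBound_of_K_ne_0 hK'.ne'] at this
  simp only [zero_mul, zero_add, sub_zero] at this
  refine this.trans ?_
  have h1 : exp (K * s) - 1 ≤ K * s * exp (K * s) := by
    have h2 := Real.add_one_le_exp (-(K * s))
    have h3 : exp (-(K * s)) * exp (K * s) = 1 := by rw [← Real.exp_add]; simp
    nlinarith [Real.exp_pos (K * s)]
  calc ‖V (γ 0)‖ / K * (exp (K * s) - 1) ≤ ‖V (γ 0)‖ / K * (K * s * exp (K * s)) := by gcongr
    _ = _ := by field_simp

lemma dist_trajectory_zero_le (hV : LipschitzWith K V) (hK : 0 < K)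
    (h : ∀ s, HasDerivAt γ (V (γ s)) s) (s : ℝ) :
    dist (γ s) (γ 0) ≤ ‖V (γ 0)‖ * |s| * exp (K * |s|) := by
  rcases le_total 0 s with hs | hs
  · rw [abs_of_nonneg hs]; exact dist_trajectory_zero_le_of_nonneg hV hK h hs
  · have := dist_trajectory_zero_le_of_nonneg (V := fun x => -V x) hV.neg hK
      (hasDerivAt_comp_neg_of_trajectory h) (neg_nonneg.2 hs)
    simpa [abs_of_nonpos hs] using this

/-- `Φ` is the global flow of the autonomous vector field `V`. -/
structure IsGlobalFlow (V : E → E) (Φ : ℝ → E → E) : Prop where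
  zero : ∀ z, Φ 0 z = z
  hasDerivAt : ∀ z s, HasDerivAt (fun s => Φ s z) (V (Φ s z)) s

namespace IsGlobalFlow

variable {Φ : ℝ → E → E}

lemma dist_le (hΦ : IsGlobalFlow V Φ) (hV : LipschitzWith K V) (s : ℝ) (z w : E) :
    dist (Φ s z) (Φ s w) ≤ dist z w * exp (K * |s|) := by
  simpa [hΦ.zero] using dist_trajectories_le hV (hΦ.hasDerivAt z) (hΦ.hasDerivAt w) s

lemma lipschitzWith (hΦ : IsGlobalFlow V Φ) (hV : LipschitzWith K V) (s : ℝ) :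
    LipschitzWith (exp (K * |s|)).toNNReal (Φ s) :=
  LipschitzWith.of_dist_le_mul fun z w => by
    rw [Real.coe_toNNReal _ (Real.exp_pos _).le, mul_comm]; exact hΦ.dist_le hV s z w

lemma add (hΦ : IsGlobalFlow V Φ) (hV : LipschitzWith K V) (s h : ℝ) (z : E) :
    Φ (s + h) z = Φ h (Φ s z) := by
  have h1 : ∀ h, HasDerivAt (fun h => Φ (s + h) z) (V (Φ (s + h) z)) h := fun h => by
    simpa [Function.comp_def] using
      (hΦ.hasDerivAt z (s + h)).scomp h ((hasDerivAt_id h).const_add s)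
  have := dist_trajectories_le hV h1 (hΦ.hasDerivAt (Φ s z)) h
  simpa [hΦ.zero] using this

lemma norm_sub_le (hΦ : IsGlobalFlow V Φ) (hV : LipschitzWith K V) (hK : 0 < K) {h : ℝ}
    (hh : |h| ≤ 1) (z : E) :
    ‖Φ h z - z‖ ≤ (‖V 0‖ + K) * exp K * |h| * (1 + ‖z‖) := by
  have h1 := dist_trajectory_zero_le hV hK (hΦ.hasDerivAt z) h
  rw [hΦ.zero, dist_eq_norm] at h1
  have h2 : ‖V z‖ ≤ (‖V 0‖ + K) * (1 + ‖z‖) := by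
    have h3 := hV.dist_le_mul z 0
    rw [dist_eq_norm, dist_zero_right] at h3
    have h4 := norm_le_norm_add_norm_sub' (V z) (V 0)
    have := norm_nonneg z
    have := norm_nonneg (V 0)
    have := K.coe_nonneg
    nlinarith
  calc ‖Φ h z - z‖ ≤ ‖V z‖ * |h| * exp (K * |h|) := h1
    _ ≤ ((‖V 0‖ + K) * (1 + ‖z‖)) * |h| * exp (K * 1) := by gcongr
    _ = _ := by ring_nf

lemma continuous_uncurry (hΦ : IsGlobalFlow V Φ) (hV : LipschitzWith K V) :
    Continuous (fun p : ℝ × E => Φ p.1 p.2) := by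
  rw [continuous_iff_continuousAt]
  rintro ⟨s, z⟩
  have h1 : ContinuousAt (fun p : ℝ × E => Φ p.1 z) (s, z) :=
    ContinuousAt.comp (g := fun s => Φ s z) (f := Prod.fst) (x := (s, z))
      (hΦ.hasDerivAt z s).continuousAt continuousAt_fst
  refine tendsto_iff_dist_tendsto_zero.2 ?_
  have h2 : Filter.Tendsto (fun p : ℝ × E => dist p.2 z * exp (K * |p.1|)
      + dist (Φ p.1 z) (Φ s z)) (nhds (s, z)) (nhds (dist z z * exp (K * |s|)
      + dist (Φ s z) (Φ s z))) := by
    have h3 : Continuous fun p : ℝ × E => dist p.2 z * exp (K * |p.1|) := by fun_prop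
    exact h3.continuousAt.add (h1.dist continuousAt_const)
  simp only [dist_self, zero_mul, add_zero] at h2
  exact squeeze_zero (fun _ => dist_nonneg)
    (fun p => (dist_triangle _ (Φ p.1 z) _).trans (by gcongr; exact hΦ.dist_le hV _ _ _)) h2

lemma hasCompactSupport_comp (hΦ : IsGlobalFlow V Φ) (hV : LipschitzWith K V) {g : E → ℝ}
    (hgc : HasCompactSupport g) (s : ℝ) : HasCompactSupport fun z => g (Φ s z) := by
  refine HasCompactSupport.intro (hgc.isCompact.image (hΦ.lipschitzWith hV (-s)).continuous)
    fun z hz => image_eq_zero_of_notMem_tsupport fun h => hz ⟨Φ s z, h, ?_⟩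
  rw [← hΦ.add hV, add_neg_cancel, hΦ.zero]

end IsGlobalFlow

end LipschitzFlow

section Liouville

variable {E : Type*} [NormedAddCommGroup E] [NormedSpace ℝ E] {V : E → E} {K : ℝ≥0}
  {Φ : ℝ → E → E} [ProperSpace E] [MeasurableSpace E] [BorelSpace E] {μ : Measure E}
  [IsFiniteMeasureOnCompacts μ]

namespace IsGlobalFlow

/-- If the flow agrees to first order with measure preserving maps, the integral of a compactly
supported Lipschitz function along the flow has zero derivative. -/
lemma hasDerivAt_integral_comp_zero (hΦ : IsGlobalFlow V Φ) (hV : LipschitzWith K V) (hK : 0 < K)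
    {T : ℝ → E → E} (hT : ∀ h, MeasurePreserving (T h) μ μ) {C : ℝ}
    (hTd : ∀ h, |h| ≤ 1 → ∀ z, ‖T h z - z‖ ≤ C * |h| * (1 + ‖z‖))
    (hT' : ∀ z, HasDerivAt (fun h => T h z) (V z) 0)
    {g : E → ℝ} {M : ℝ≥0} (hg : LipschitzWith M g) (hgc : HasCompactSupport g) :
    HasDerivAt (fun h => ∫ z, g (Φ h z) ∂μ) 0 0 := by
  obtain ⟨D, hD1, hΦD, hTD⟩ : ∃ D : ℝ, 1 ≤ D ∧
      (∀ h, |h| ≤ 1 → ∀ z, ‖Φ h z - z‖ ≤ D * |h| * (1 + ‖z‖)) ∧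
      (∀ h, |h| ≤ 1 → ∀ z, ‖T h z - z‖ ≤ D * |h| * (1 + ‖z‖)) := by
    refine ⟨max 1 (max ((‖V 0‖ + K) * exp K) C), le_max_left _ _, fun h hh z => ?_,
      fun h hh z => ?_⟩
    · refine (hΦ.norm_sub_le hV hK hh z).trans ?_
      gcongr
      exact (le_max_left _ _).trans (le_max_right _ _)
    · refine (hTd h hh z).trans ?_
      gcongr
      exact (le_max_right _ _).trans (le_max_right _ _)
  obtain ⟨R, hR⟩ : ∃ R : ℝ, ∀ z, R < ‖z‖ → g z = 0 := by
    obtain ⟨R, hR⟩ := hgc.isCompact.isBounded.subset_closedBall 0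
    refine ⟨R, fun z hz => image_eq_zero_of_notMem_tsupport fun h => ?_⟩
    have := hR h
    simp at this
    linarith
  have hfar : ∀ (S : E → E) (h : ℝ), |h| ≤ (2 * D)⁻¹ →
      (∀ z, ‖S z - z‖ ≤ D * |h| * (1 + ‖z‖)) → ∀ z, 2 * R + 1 < ‖z‖ → g (S z) = 0 := by
    intro S h hh hS z hz
    refine hR _ ?_
    have h1 : D * |h| ≤ 1 / 2 := by
      calc D * |h| ≤ D * (2 * D)⁻¹ := by gcongr
        _ = 1 / 2 := by field_simp
    have h2 := hS z
    have h3 := norm_sub_norm_le z (S z)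
    rw [norm_sub_rev] at h3
    have h4 : D * |h| * (1 + ‖z‖) ≤ 1 / 2 * (1 + ‖z‖) := by gcongr
    linarith
  have hsmall : ∀ᶠ h : ℝ in nhdsWithin 0 {0}ᶜ, |h| ≤ (2 * D)⁻¹ ∧ |h| ≤ 1 ∧ h ≠ 0 := by
    have : ∀ᶠ h : ℝ in nhds 0, |h| < (2 * D)⁻¹ := by
      have := (continuous_abs (G := ℝ)).tendsto 0
      rw [abs_zero] at this
      exact this.eventually_lt_const (by positivity)
    filter_upwards [nhdsWithin_le_nhds this, self_mem_nhdsWithin] with h h1 h2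
    refine ⟨h1.le, h1.le.trans ?_, h2⟩
    exact inv_le_one_of_one_le₀ (by linarith)
  have hgint : Integrable g μ := hg.continuous.integrable_of_hasCompactSupport hgc
  have hcΦ : ∀ h, Continuous fun z => g (Φ h z) := fun h =>
    hg.continuous.comp (hΦ.lipschitzWith hV h).continuous
  have hbd : Integrable (fun z => (Metric.closedBall (0 : E) (2 * R + 1)).indicator
      (fun z => M * (2 * D * (1 + ‖z‖))) z) μ := by
    refine IntegrableOn.integrable_indicator ?_ Metric.isClosed_closedBall.measurableSet
    exact ContinuousOn.integrableOn_compact (isCompact_closedBall _ _) (by fun_prop)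
  rw [hasDerivAt_iff_tendsto_slope_zero]
  have hlim : Filter.Tendsto (fun h : ℝ => ∫ z, h⁻¹ * (g (Φ h z) - g (T h z)) ∂μ)
      (nhdsWithin 0 {0}ᶜ) (nhds (∫ _, (0 : ℝ) ∂μ)) := by
    refine tendsto_integral_filter_of_dominated_convergence
      (fun z => (Metric.closedBall (0 : E) (2 * R + 1)).indicator
        (fun z => M * (2 * D * (1 + ‖z‖))) z) ?_ ?_ hbd ?_
    · refine Filter.Eventually.of_forall fun h => ?_
      exact (((hcΦ h).aestronglyMeasurable).sub
        (hg.continuous.measurable.comp (hT h).measurable).aestronglyMeasurable).const_mul _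
    · filter_upwards [hsmall] with h ⟨h1, h2, h3⟩
      refine Filter.Eventually.of_forall fun z => ?_
      have hh : 0 < |h| := abs_pos.2 h3
      by_cases hz : z ∈ Metric.closedBall (0 : E) (2 * R + 1)
      · rw [Set.indicator_of_mem hz, norm_mul, norm_inv, Real.norm_eq_abs h,
          inv_mul_le_iff₀ hh, ← dist_eq_norm]
        calc dist (g (Φ h z)) (g (T h z)) ≤ M * dist (Φ h z) (T h z) := hg.dist_le_mul _ _
          _ ≤ M * (‖Φ h z - z‖ + ‖T h z - z‖) := by
            gcongr
            rw [← dist_eq_norm, ← dist_eq_norm]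
            exact dist_triangle_right _ _ _
          _ ≤ M * (D * |h| * (1 + ‖z‖) + D * |h| * (1 + ‖z‖)) := by
            gcongr
            · exact hΦD h h2 z
            · exact hTD h h2 z
          _ = _ := by ring
      · have hz' : 2 * R + 1 < ‖z‖ := by simpa using hz
        rw [Set.indicator_of_notMem hz, hfar _ h h1 (hΦD h h2) z hz',
          hfar _ h h1 (hTD h h2) z hz']
        simp
    · refine Filter.Eventually.of_forall fun z => ?_
      have hT0 : T 0 z = z := by simpa [sub_eq_zero] using hTd 0 (by simp) z
      have hd : HasDerivAt (fun h => Φ h z - T h z) 0 0 := by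
        have := (hΦ.hasDerivAt z 0).sub (hT' z)
        rwa [hΦ.zero, sub_self] at this
      rw [hasDerivAt_iff_tendsto_slope_zero] at hd
      simp only [zero_add, hΦ.zero, hT0, sub_self, sub_zero] at hd
      have hd2 := hd.norm.const_mul (M : ℝ)
      rw [norm_zero, mul_zero] at hd2
      refine squeeze_zero_norm (fun h => ?_) hd2
      rw [norm_mul, norm_smul, mul_left_comm, ← dist_eq_norm, ← dist_eq_norm]
      gcongr
      exact hg.dist_le_mul _ _
  rw [integral_zero] at hlim
  refine hlim.congr' ?_
  filter_upwards [hsmall] with h ⟨h1, h2, h3⟩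
  have e1 : ∫ z, g (T h z) ∂μ = ∫ z, g z ∂μ := by
    have := integral_map (μ := μ) (hT h).aemeasurable (f := g)
      (hg.continuous.aestronglyMeasurable)
    rw [(hT h).map_eq] at this
    exact this.symm
  have i1 : Integrable (fun z => g (T h z)) μ :=
    (hT h).integrable_comp_of_integrable hgint
  have i2 : Integrable (fun z => g (Φ h z)) μ := by
    refine (hcΦ h).integrable_of_hasCompactSupport ?_
    refine HasCompactSupport.intro (isCompact_closedBall (0 : E) (2 * R + 1)) fun z hz => ?_
    exact hfar _ h h1 (hΦD h h2) z (by simpa using hz)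
  rw [integral_const_mul, integral_sub i2 i1, e1]
  simp [hΦ.zero]

lemma integral_comp_eq (hΦ : IsGlobalFlow V Φ) (hV : LipschitzWith K V) (hK : 0 < K)
    {T : ℝ → E → E} (hT : ∀ h, MeasurePreserving (T h) μ μ) {C : ℝ}
    (hTd : ∀ h, |h| ≤ 1 → ∀ z, ‖T h z - z‖ ≤ C * |h| * (1 + ‖z‖))
    (hT' : ∀ z, HasDerivAt (fun h => T h z) (V z) 0)
    {g : E → ℝ} {M : ℝ≥0} (hg : LipschitzWith M g) (hgc : HasCompactSupport g) (t : ℝ) :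
    ∫ z, g (Φ t z) ∂μ = ∫ z, g z ∂μ := by
  have hd : ∀ s, HasDerivAt (fun s => ∫ z, g (Φ s z) ∂μ) 0 s := fun s => by
    have h1 := hΦ.hasDerivAt_integral_comp_zero hV hK hT hTd hT'
      (hg.comp (hΦ.lipschitzWith hV s)) (hΦ.hasCompactSupport_comp hV hgc s)
    have h2 := h1.scomp_of_eq s ((hasDerivAt_id s).sub_const s) (by simp)
    simp only [smul_zero] at h2
    refine h2.congr_of_eventuallyEq (Filter.Eventually.of_forall fun u => ?_)
    have e' : ∀ z, Φ u z = Φ s (Φ (u - s) z) := fun z => by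
      rw [← hΦ.add hV, sub_add_cancel]
    simp [Function.comp, e']
  have := is_const_of_deriv_eq_zero (fun s => (hd s).differentiableAt) (fun s => (hd s).deriv) t 0
  simpa [hΦ.zero] using this

/-- Abstract Liouville theorem: a Lipschitz flow agreeing to first order with measure preserving
maps is measure preserving. -/
theorem measurePreserving (hΦ : IsGlobalFlow V Φ) (hV : LipschitzWith K V) (hK : 0 < K)
    {T : ℝ → E → E} (hT : ∀ h, MeasurePreserving (T h) μ μ) {C : ℝ}
    (hTd : ∀ h, |h| ≤ 1 → ∀ z, ‖T h z - z‖ ≤ C * |h| * (1 + ‖z‖))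
    (hT' : ∀ z, HasDerivAt (fun h => T h z) (V z) 0) (t : ℝ) :
    MeasurePreserving (Φ t) μ μ := by
  have hc : ∀ s, Continuous (Φ s) := fun s => (hΦ.lipschitzWith hV s).continuous
  have hinv : ∀ z, Φ (-t) (Φ t z) = z := fun z => by
    rw [← hΦ.add hV, add_neg_cancel, hΦ.zero]
  have hpre : ∀ S : Set E, IsCompact S → IsCompact (Φ t ⁻¹' S) := fun S hS => by
    refine (hS.image (hc (-t))).of_isClosed_subset (hS.isClosed.preimage (hc t)) ?_
    exact fun z hz => ⟨Φ t z, hz, hinv z⟩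
  refine ⟨(hc t).measurable, ?_⟩
  have : IsFiniteMeasureOnCompacts (μ.map (Φ t)) := ⟨fun S hS => by
    rw [Measure.map_apply (hc t).measurable hS.measurableSet]
    exact (hpre S hS).measure_lt_top⟩
  apply Measure.OuterRegular.ext_isOpen
  apply Measure.InnerRegularWRT.eq_of_innerRegularWRT_of_forall_eq Measure.Regular.innerRegular
    Measure.Regular.innerRegular
  intro S hS
  rcases S.eq_empty_or_nonempty with rfl | hne
  · simp
  set g : ℕ → E → ℝ := fun n z => max 0 (1 - n * Metric.infDist z S) with hgdef
  have hgL : ∀ n, ∃ M, LipschitzWith M (g n) := fun n => by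
    have h1 : LipschitzWith n fun z => (n : ℝ) * Metric.infDist z S := by
      refine LipschitzWith.of_dist_le_mul fun x y => ?_
      have := (Metric.lipschitz_infDist_pt S).dist_le_mul x y
      simp only [Real.dist_eq, NNReal.coe_one, one_mul, NNReal.coe_natCast] at this ⊢
      rw [← mul_sub, abs_mul, Nat.abs_cast]
      gcongr
    exact ⟨_, ((LipschitzWith.const 1).sub h1).const_max 0⟩
  have hgc : ∀ n, 1 ≤ n → HasCompactSupport (g n) := fun n hn => by
    refine HasCompactSupport.intro (hS.cthickening (r := 1)) fun z hz => ?_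
    have h1 : 1 < Metric.infDist z S := by
      by_contra! h
      refine hz (Metric.mem_cthickening_iff.2 ?_)
      rw [← ENNReal.ofReal_toReal (Metric.infEDist_ne_top hne)]
      exact ENNReal.ofReal_le_ofReal h
    have h2 : (1 : ℝ) ≤ n := by exact_mod_cast hn
    exact max_eq_left (by nlinarith)
  have hmono : ∀ n, 1 ≤ n → ∀ z, g n z ≤ g 1 z := fun n hn z => by
    have h2 : (1 : ℝ) ≤ n := by exact_mod_cast hn
    have h3 : 0 ≤ Metric.infDist z S := Metric.infDist_nonneg
    refine max_le_max_left _ ?_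
    push_cast
    nlinarith
  have hpt : ∀ z, Filter.Tendsto (fun n => g n z) Filter.atTop
      (nhds (S.indicator (fun _ => (1 : ℝ)) z)) := fun z => by
    by_cases hz : z ∈ S
    · simp [hgdef, Metric.infDist_zero_of_mem hz, hz]
    · rw [Set.indicator_of_notMem hz]
      have h3 : 0 < Metric.infDist z S := (hS.isClosed.notMem_iff_infDist_pos hne).1 hz
      have h4 : Filter.Tendsto (fun n : ℕ => (n : ℝ) * Metric.infDist z S) Filter.atTop
          Filter.atTop := tendsto_natCast_atTop_atTop.atTop_mul_const h3
      refine tendsto_const_nhds.congr' ?_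
      filter_upwards [h4.eventually_ge_atTop 1] with n hn
      exact (max_eq_left (by linarith)).symm
  have hlim : ∀ ν : Measure E, IsFiniteMeasureOnCompacts ν →
      Filter.Tendsto (fun n => ∫ z, g n z ∂ν) Filter.atTop (nhds (ν.real S)) := by
    intro ν _
    have h1 : ∫ z, S.indicator (fun _ => (1 : ℝ)) z ∂ν = ν.real S := by
      rw [integral_indicator hS.measurableSet]; simp
    rw [← h1]
    refine tendsto_integral_filter_of_dominated_convergence (g 1) ?_ ?_ ?_
      (Filter.Eventually.of_forall hpt)
    · exact Filter.Eventually.of_forall fun n => (hgL n).choose_spec.continuous.aestronglyMeasurable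
    · filter_upwards [Filter.eventually_ge_atTop 1] with n hn
      refine Filter.Eventually.of_forall fun z => ?_
      rw [Real.norm_of_nonneg (le_max_left _ _)]
      exact hmono n hn z
    · exact (hgL 1).choose_spec.continuous.integrable_of_hasCompactSupport (hgc 1 le_rfl)
  have heq : (μ.map (Φ t)).real S = μ.real S := by
    refine tendsto_nhds_unique (hlim _ inferInstance) ((hlim μ inferInstance).congr' ?_)
    filter_upwards [Filter.eventually_ge_atTop 1] with n hn
    obtain ⟨M, hM⟩ := hgL n
    rw [integral_map (hc t).aemeasurable hM.continuous.aestronglyMeasurable,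
      hΦ.integral_comp_eq hV hK hT hTd hT' hM (hgc n hn)]
  exact (measureReal_eq_measureReal_iff hS.measure_lt_top.ne hS.measure_lt_top.ne).1 heq

end IsGlobalFlow

end Liouville

section Hamiltonian

lemma stdGaussian_eq_withDensity (d : ℕ) : ∃ c : ℝ, stdGaussian d =
    volume.withDensity fun p => ENNReal.ofReal (c * exp (-‖p‖ ^ 2 / 2)) := by
  set b : ℂ := 1 / 2 with hb
  have hbre : 0 < b.re := by simp [hb]
  have hint : Integrable fun p : Euc d => exp (-(1 / 2 : ℝ) * ‖p‖ ^ 2) := by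
    have := (GaussianFourier.integrable_cexp_neg_mul_sq_norm_add hbre 0 (0 : Euc d)).re
    refine this.congr (Filter.Eventually.of_forall fun p => ?_)
    have : Complex.exp (-b * ‖p‖ ^ 2 + 0 * ((⟪(0 : Euc d), p⟫ : ℝ) : ℂ))
        = ((exp (-(1 / 2 : ℝ) * ‖p‖ ^ 2) : ℝ) : ℂ) := by
      push_cast; simp [hb]
    change (Complex.exp (-b * ‖p‖ ^ 2 + 0 * ((⟪(0 : Euc d), p⟫ : ℝ) : ℂ))).re = _
    rw [this, Complex.ofReal_re]
  set I0 : ℝ := ∫ p : Euc d, exp (-(1 / 2 : ℝ) * ‖p‖ ^ 2) with hI0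
  have hI0pos : I0 ≠ 0 := by
    rw [hI0, GaussianFourier.integral_rexp_neg_mul_sq_norm (by norm_num)]
    positivity
  have hI0c : (I0 : ℂ) = (Real.pi / b) ^ (Module.finrank ℝ (Euc d) / 2 : ℂ) := by
    rw [← GaussianFourier.integral_cexp_neg_mul_sq_norm hbre, hI0, ← integral_complex_ofReal]
    push_cast
    simp [hb]
  have hI0nn : 0 ≤ I0⁻¹ := inv_nonneg.2 (integral_nonneg fun _ => (exp_pos _).le)
  have heq : ∀ p : Euc d, exp (-‖p‖ ^ 2 / 2) = exp (-(1 / 2 : ℝ) * ‖p‖ ^ 2) := fun p => by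
    congr 1; ring
  refine ⟨I0⁻¹, ?_⟩
  simp_rw [heq]
  have : IsFiniteMeasure (volume.withDensity fun p : Euc d =>
      ENNReal.ofReal (I0⁻¹ * exp (-(1 / 2 : ℝ) * ‖p‖ ^ 2))) :=
    isFiniteMeasure_withDensity_ofReal (hint.const_mul _).2
  refine Measure.ext_of_charFun (funext fun t => ?_)
  rw [stdGaussian_eq_mathlib, ProbabilityTheory.charFun_stdGaussian, charFun_apply,
    integral_withDensity_eq_integral_toReal_smul (by fun_prop) (by simp)]
  have e : ∀ p : Euc d, (ENNReal.ofReal (I0⁻¹ * exp (-(1 / 2 : ℝ) * ‖p‖ ^ 2))).toReal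
      • Complex.exp (⟪p, t⟫ * Complex.I)
      = (I0 : ℂ)⁻¹ * Complex.exp (-b * ‖p‖ ^ 2 + Complex.I * ⟪t, p⟫) := fun p => by
    rw [ENNReal.toReal_ofReal (by positivity), Complex.real_smul, Complex.exp_add, real_inner_comm]
    push_cast
    rw [hb]; ring_nf
  simp_rw [e]
  rw [integral_const_mul, GaussianFourier.integral_cexp_neg_mul_sq_norm_add hbre, ← hI0c,
    ← mul_assoc, inv_mul_cancel₀ (by exact_mod_cast hI0pos), one_mul, hb, Complex.I_sq]
  congr 1; ring

lemma measurePreserving_withDensity {α : Type*} [MeasurableSpace α] {μ : Measure α} {Φ : α → α}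
    (hΦ : MeasurePreserving Φ μ μ) {ρ : α → ℝ≥0∞} (hρ : Measurable ρ) (h : ∀ x, ρ (Φ x) = ρ x) :
    MeasurePreserving Φ (μ.withDensity ρ) (μ.withDensity ρ) := by
  refine ⟨hΦ.measurable, ?_⟩
  ext s hs
  rw [Measure.map_apply hΦ.measurable hs, withDensity_apply _ hs,
    withDensity_apply _ (hΦ.measurable hs), ← hΦ.setLIntegral_comp_preimage hs hρ]
  simp_rw [h]

variable {d : ℕ} {f : Euc d → ℝ} {L : ℝ}

lemma contDiff_gradient {n : ℕ} (hf : ContDiff ℝ (n + 1) f) : ContDiff ℝ n (gradient f) :=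
  (InnerProductSpace.toDual ℝ (Euc d)).symm.contDiff.comp (hf.fderiv_right le_rfl)

lemma LSmooth.nonneg (hL : LSmooth f L) : 0 ≤ L := (norm_nonneg _).trans (hL 0)

lemma LSmooth.lipschitzWith (hL : LSmooth f L) (hf : ContDiff ℝ 2 f) :
    LipschitzWith L.toNNReal (gradient f) :=
  lipschitzWith_of_nnnorm_fderiv_le ((contDiff_gradient (n := 1) hf).differentiable (by simp))
    fun x => by
      rw [← NNReal.coe_le_coe, Real.coe_toNNReal _ hL.nonneg]; exact hL x

/-- The Hamiltonian vector field of `f q + ‖p‖² / 2`. -/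
noncomputable def hamField (f : Euc d → ℝ) (z : Euc d × Euc d) : Euc d × Euc d :=
  (z.2, -gradient f z.1)

lemma LSmooth.lipschitzWith_hamField (hL : LSmooth f L) (hf : ContDiff ℝ 2 f) :
    LipschitzWith (max 1 L.toNNReal) (hamField f) := by
  have h := (LipschitzWith.prod_snd (α := Euc d) (β := Euc d)).prodMk
    ((hL.lipschitzWith hf).comp (LipschitzWith.prod_fst (α := Euc d) (β := Euc d))).neg
  rwa [mul_one] at h

/-- One step of the symplectic Euler scheme. -/
noncomputable def symplecticEuler (f : Euc d → ℝ) (h : ℝ) (z : Euc d × Euc d) : Euc d × Euc d :=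
  (z.1 + h • z.2, z.2 - h • gradient f (z.1 + h • z.2))

lemma measurePreserving_symplecticEuler (hf : ContDiff ℝ 2 f) (h : ℝ) :
    MeasurePreserving (symplecticEuler f h) volume volume := by
  have hg : Measurable (gradient f) := (contDiff_gradient (n := 1) hf).continuous.measurable
  have kick : MeasurePreserving (fun z : Euc d × Euc d => (z.1, z.2 - h • gradient f z.1))
      volume volume :=
    (MeasurePreserving.id (volume : Measure (Euc d))).skew_product
      (g := fun q p => p - h • gradient f q)
      (by unfold Function.uncurry; fun_prop)
      (Filter.Eventually.of_forall fun q => map_sub_right_eq_self volume (h • gradient f q))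
  have drift' : MeasurePreserving (fun z : Euc d × Euc d => (z.1, z.2 + h • z.1))
      volume volume :=
    (MeasurePreserving.id (volume : Measure (Euc d))).skew_product
      (g := fun p q => q + h • p)
      (by unfold Function.uncurry; fun_prop)
      (Filter.Eventually.of_forall fun p => map_add_right_eq_self volume (h • p))
  have swap : MeasurePreserving (Prod.swap : Euc d × Euc d → Euc d × Euc d) volume volume :=
    Measure.measurePreserving_swap
  exact kick.comp (swap.comp (drift'.comp swap))

lemma norm_symplecticEuler_sub_le (hf : ContDiff ℝ 2 f) (hL : LSmooth f L) {h : ℝ} (hh : |h| ≤ 1)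
    (z : Euc d × Euc d) :
    ‖symplecticEuler f h z - z‖ ≤ (1 + ‖gradient f 0‖ + 2 * L) * |h| * (1 + ‖z‖) := by
  have h1 := (norm_fst_le z)
  have h2 := (norm_snd_le z)
  have h0 := norm_nonneg z
  have hg0 := norm_nonneg (gradient f 0)
  have hL0 := hL.nonneg
  have h3 : ‖gradient f (z.1 + h • z.2)‖ ≤ ‖gradient f 0‖ + 2 * L * ‖z‖ := by
    have h4 := (hL.lipschitzWith hf).dist_le_mul (z.1 + h • z.2) 0
    rw [Real.coe_toNNReal _ hL0, dist_eq_norm, dist_zero_right] at h4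
    have h5 := norm_le_norm_add_norm_sub' (gradient f (z.1 + h • z.2)) (gradient f 0)
    have h6 : ‖z.1 + h • z.2‖ ≤ 2 * ‖z‖ := by
      refine (norm_add_le _ _).trans ?_
      rw [norm_smul, Real.norm_eq_abs]
      have : |h| * ‖z.2‖ ≤ 1 * ‖z‖ := by gcongr
      linarith
    nlinarith
  have e : symplecticEuler f h z - z = (h • z.2, -(h • gradient f (z.1 + h • z.2))) := by
    simp [symplecticEuler, Prod.ext_iff]
  rw [e, Prod.norm_def, norm_neg, norm_smul, norm_smul, Real.norm_eq_abs, mul_comm _ |h|,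
    mul_assoc, ← mul_max_of_nonneg _ _ (abs_nonneg h)]
  gcongr
  refine max_le ?_ ?_
  · nlinarith [mul_nonneg hg0 h0, mul_nonneg hL0 h0]
  · nlinarith [mul_nonneg hg0 h0, mul_nonneg hL0 h0]

lemma hasDerivAt_symplecticEuler (hf : ContDiff ℝ 2 f) (z : Euc d × Euc d) :
    HasDerivAt (fun h => symplecticEuler f h z) (hamField f z) 0 := by
  have h1 : HasDerivAt (fun h : ℝ => z.1 + h • z.2) z.2 0 := by
    simpa using ((hasDerivAt_id (0 : ℝ)).smul_const z.2).const_add z.1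
  have hd : DifferentiableAt ℝ (gradient f) (z.1 + (0 : ℝ) • z.2) :=
    (contDiff_gradient (n := 1) hf).differentiable (by simp) _
  have h2 := (hd.hasFDerivAt.comp_hasDerivAt (0 : ℝ) h1)
  have h3 := ((hasDerivAt_id (0 : ℝ)).smul h2).const_sub z.2
  simp only [id, zero_smul, add_zero, one_smul, zero_add, Function.comp_def] at h3
  exact h1.prodMk h3

variable {Q P : Euc d × Euc d → ℝ → Euc d}

lemma isGlobalFlow_hamField (hQ0 : ∀ z, Q z 0 = z.1) (hP0 : ∀ z, P z 0 = z.2)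
    (hQ : ∀ z s, HasDerivAt (Q z) (P z s) s)
    (hP : ∀ z s, HasDerivAt (P z) (-(gradient f (Q z s))) s) :
    IsGlobalFlow (hamField f) fun s z => (Q z s, P z s) where
  zero z := by simp [hQ0, hP0]
  hasDerivAt z s := (hQ z s).prodMk (hP z s)

lemma hamiltonian_conserved (hf : ContDiff ℝ 1 f) (hQ0 : ∀ z, Q z 0 = z.1)
    (hP0 : ∀ z, P z 0 = z.2) (hQ : ∀ z s, HasDerivAt (Q z) (P z s) s)
    (hP : ∀ z s, HasDerivAt (P z) (-(gradient f (Q z s))) s) (z : Euc d × Euc d) (t : ℝ) :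
    f (Q z t) + ‖P z t‖ ^ 2 / 2 = f z.1 + ‖z.2‖ ^ 2 / 2 := by
  have hd : ∀ s, HasDerivAt (fun s => f (Q z s) + ‖P z s‖ ^ 2 / 2) 0 s := fun s => by
    have h1 := ((hf.differentiable (by simp)) (Q z s)).hasFDerivAt.comp_hasDerivAt s (hQ z s)
    have h2 := (hP z s).norm_sq.div_const 2
    refine (h1.add h2).congr_deriv ?_
    rw [inner_neg_right, ← inner_gradient_left, real_inner_comm]
    ring
  have := is_const_of_deriv_eq_zero (fun s => (hd s).differentiableAt) (fun s => (hd s).deriv) t 0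
  simpa [hQ0, hP0] using this

/-- The Hamiltonian flow preserves the Gibbs measure. -/
theorem measurePreserving_hamiltonian_flow (hf : ContDiff ℝ 2 f) (hL : LSmooth f L)
    (hQ0 : ∀ z, Q z 0 = z.1)
    (hP0 : ∀ z, P z 0 = z.2) (hQ : ∀ z s, HasDerivAt (Q z) (P z s) s)
    (hP : ∀ z s, HasDerivAt (P z) (-(gradient f (Q z s))) s) (t : ℝ) :
    MeasurePreserving (fun z => (Q z t, P z t)) ((targetMeasure f).prod (stdGaussian d))
      ((targetMeasure f).prod (stdGaussian d)) := by
  have hvol : MeasurePreserving (fun z => (Q z t, P z t)) (volume : Measure (Euc d × Euc d))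
      volume :=
    (isGlobalFlow_hamField hQ0 hP0 hQ hP).measurePreserving (hL.lipschitzWith_hamField hf)
      (by simp) (measurePreserving_symplecticEuler hf)
      (fun h hh z => norm_symplecticEuler_sub_le hf hL hh z) (hasDerivAt_symplecticEuler hf) t
  have hfc : Measurable f := hf.continuous.measurable
  obtain ⟨c, hc⟩ := stdGaussian_eq_withDensity d
  rw [targetMeasure, hc, Measure.prod_smul_left, prod_withDensity (by fun_prop) (by fun_prop)]
  refine (measurePreserving_withDensity hvol (by fun_prop) fun z => ?_).smul_measure _
  dsimp only
  rw [← ENNReal.ofReal_mul (exp_pos _).le, ← ENNReal.ofReal_mul (exp_pos _).le, mul_left_comm,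
    mul_left_comm _ c, ← exp_add, ← exp_add]
  have := hamiltonian_conserved (hf.of_le (by norm_num)) hQ0 hP0 hQ hP z t
  congr 3
  linarith

end Hamiltonian

section GradientMoments

variable {d : ℕ} {f : Euc d → ℝ} {L Υ : ℝ}

lemma SubexpTail.exp_neg_le (hs : SubexpTail f) (hf : Continuous f) :
    ∃ lam > (0 : ℝ), ∃ M, 0 ≤ M ∧ ∀ x, exp (-f x) ≤ M * exp (-(lam * ‖x‖)) := by
  obtain ⟨lam, hlam, ht⟩ := hs
  let g : ZeroAtInftyContinuousMap (Euc d) ℝ :=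
    ⟨⟨fun x => exp (lam * ‖x‖) * exp (-f x), by fun_prop⟩, by
      rwa [← Metric.cobounded_eq_cocompact]⟩
  obtain ⟨M, hM⟩ := (ZeroAtInftyContinuousMap.isBounded_range g).exists_norm_le
  have hM' : ∀ x, exp (lam * ‖x‖) * exp (-f x) ≤ M := fun x =>
    (le_abs_self _).trans (hM (g x) ⟨x, rfl⟩)
  refine ⟨lam, hlam, M, (by positivity : (0 : ℝ) ≤ _).trans (hM' 0), fun x => ?_⟩
  rw [exp_neg (lam * ‖x‖), ← div_eq_mul_inv, le_div_iff₀ (exp_pos _), mul_comm]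
  exact hM' x

lemma SubexpTail.integrable_mul_exp_neg (hs : SubexpTail f) (hf : Continuous f) {F : Euc d → ℝ}
    (hF : Continuous F) {C : ℝ} {n : ℕ} (hb : ∀ x, |F x| ≤ C * (1 + ‖x‖) ^ n) :
    Integrable fun x => F x * exp (-f x) := by
  obtain ⟨lam, hlam, M, hM0, hM⟩ := hs.exp_neg_le hf
  set D := d + 1 with hD
  have hint : Integrable fun x : Euc d => (1 + ‖x‖) ^ (-(D : ℝ)) :=
    integrable_one_add_norm (by simp [hD])
  refine (hint.const_mul (C * M * (exp lam * ((n + D).factorial / lam ^ (n + D))))).mono'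
    (hF.mul (by fun_prop)).aestronglyMeasurable (Filter.Eventually.of_forall fun x => ?_)
  have h1 : 0 < 1 + ‖x‖ := by positivity
  have hC : 0 ≤ C := by
    have := (abs_nonneg _).trans (hb x)
    exact nonneg_of_mul_nonneg_left this (by positivity)
  have h2 := Real.pow_div_factorial_le_exp (x := lam * (1 + ‖x‖)) (by positivity) (n + D)
  have h3 : (1 + ‖x‖) ^ n * exp (-(lam * ‖x‖))
      ≤ exp lam * ((n + D).factorial / lam ^ (n + D)) * (1 + ‖x‖) ^ (-(D : ℝ)) := by
    rw [rpow_neg h1.le, rpow_natCast, exp_neg, ← div_eq_mul_inv, ← div_eq_mul_inv,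
      div_le_div_iff₀ (exp_pos _) (by positivity), ← pow_add]
    rw [mul_pow, mul_add, mul_one, exp_add, div_le_iff₀ (by positivity)] at h2
    have h4 : (0 : ℝ) < lam ^ (n + D) := by positivity
    calc (1 + ‖x‖) ^ (n + D) = lam ^ (n + D) * (1 + ‖x‖) ^ (n + D) / lam ^ (n + D) := by
          field_simp
      _ ≤ (exp lam * exp (lam * ‖x‖) * (n + D).factorial) / lam ^ (n + D) := by
          gcongr
      _ = _ := by ring
  rw [norm_mul, norm_eq_abs, norm_of_nonneg (exp_pos _).le]
  calc |F x| * exp (-f x) ≤ (C * (1 + ‖x‖) ^ n) * (M * exp (-(lam * ‖x‖))) := by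
        gcongr
        exacts [hb x, hM x]
    _ = C * M * ((1 + ‖x‖) ^ n * exp (-(lam * ‖x‖))) := by ring
    _ ≤ C * M * (exp lam * ((n + D).factorial / lam ^ (n + D)) * (1 + ‖x‖) ^ (-(D : ℝ))) := by
        gcongr
    _ = _ := by ring

lemma LSmooth.norm_gradient_le (hL : LSmooth f L) (hf : ContDiff ℝ 2 f) (x : Euc d) :
    ‖gradient f x‖ ≤ (‖gradient f 0‖ + L) * (1 + ‖x‖) := by
  have h4 := (hL.lipschitzWith hf).dist_le_mul x 0
  rw [Real.coe_toNNReal _ hL.nonneg, dist_eq_norm, dist_zero_right] at h4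
  have h5 := norm_le_norm_add_norm_sub' (gradient f x) (gradient f 0)
  have h6 := hL.nonneg
  nlinarith [norm_nonneg x, norm_nonneg (gradient f 0),
    mul_nonneg (norm_nonneg x) (norm_nonneg (gradient f 0))]

lemma LSmooth.integrable_mul_exp_neg (hL : LSmooth f L) (hf : ContDiff ℝ 2 f) (hs : SubexpTail f)
    {F : Euc d → ℝ} (hF : Continuous F) {C : ℝ} {n : ℕ} (hC : 0 ≤ C)
    (hb : ∀ x, |F x| ≤ C * ‖gradient f x‖ ^ n) :
    Integrable fun x => F x * exp (-f x) := by
  refine hs.integrable_mul_exp_neg hf.continuous hF (C := C * (‖gradient f 0‖ + L) ^ n) (n := n)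
    fun x => (hb x).trans ?_
  rw [mul_assoc, ← mul_pow]
  gcongr
  exact hL.norm_gradient_le hf x

lemma hasFDerivAt_exp_neg (hf : ContDiff ℝ 1 f) (x v : Euc d) :
    DifferentiableAt ℝ (fun x => exp (-f x)) x ∧
      fderiv ℝ (fun x => exp (-f x)) x v = -⟪gradient f x, v⟫ * exp (-f x) := by
  have h := ((hf.differentiable (by simp)) x).hasFDerivAt.neg.exp
  refine ⟨h.differentiableAt, ?_⟩
  have h2 := h.fderiv
  change fderiv ℝ (fun x => exp (-f x)) x = _ at h2
  rw [h2, inner_gradient_left]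
  simp [mul_comm]

lemma integral_norm_gradient_pow_succ_le (hf : ContDiff ℝ 2 f) (hL : LSmooth f L)
    (hs : SubexpTail f)
    (hΥ : ∀ x : Euc d,
      LinearMap.trace ℝ (Euc d) (fderiv ℝ (gradient f) x : Euc d →ₗ[ℝ] Euc d) ≤ Υ) (k : ℕ) :
    ∫ x, (‖gradient f x‖ ^ 2) ^ (k + 1) * exp (-f x)
      ≤ (Υ + 2 * k * L) * ∫ x, (‖gradient f x‖ ^ 2) ^ k * exp (-f x) := by
  set G := gradient f with hG
  have hL0 := hL.nonneg
  have hGc : ContDiff ℝ 1 G := contDiff_gradient (n := 1) hf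
  have hGd : ∀ x, HasFDerivAt G (fderiv ℝ G x) x := fun x =>
    (hGc.differentiable (by simp) x).hasFDerivAt
  have hH : Continuous (fderiv ℝ G) := hGc.continuous_fderiv (by simp)
  have hGcont : Continuous G := hGc.continuous
  let b := EuclideanSpace.basisFun (Fin d) ℝ
  have hb1 : ∀ i, ‖b i‖ = 1 := b.norm_eq_one
  have hbG : ∀ i x, |⟪b i, G x⟫| ≤ ‖G x‖ := fun i x => by
    simpa [hb1] using abs_real_inner_le_norm (b i) (G x)
  let φ : Fin d → Euc d → ℝ := fun i x => (‖G x‖ ^ 2) ^ k * ⟪b i, G x⟫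
  let φ' : Fin d → Euc d → ℝ := fun i x =>
    (‖G x‖ ^ 2) ^ k * ⟪b i, fderiv ℝ G x (b i)⟫
      + k * (‖G x‖ ^ 2) ^ (k - 1) * (2 * ⟪G x, fderiv ℝ G x (b i)⟫) * ⟪b i, G x⟫
  have hφd : ∀ i x, DifferentiableAt ℝ (φ i) x ∧ fderiv ℝ (φ i) x (b i) = φ' i x := by
    intro i x
    have h1 := ((hGd x).norm_sq.pow k).mul ((hasFDerivAt_const (b i) x).inner ℝ (hGd x))
    refine ⟨h1.differentiableAt, ?_⟩
    have h2 := h1.fderiv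
    change fderiv ℝ (φ i) x = _ at h2
    rw [h2]
    simp [φ', fderivInnerCLM_apply]
    ring
  have hφc : ∀ i, Continuous (φ i) := fun i => by fun_prop
  have hφ'c : ∀ i, Continuous (φ' i) := fun i => by fun_prop
  have hfd : ∀ x v, DifferentiableAt ℝ (fun x => exp (-f x)) x ∧
      fderiv ℝ (fun x => exp (-f x)) x v = -⟪G x, v⟫ * exp (-f x) := fun x v =>
    hasFDerivAt_exp_neg (hf.of_le (by norm_num)) x v
  have hHb : ∀ i x, ‖fderiv ℝ G x (b i)‖ ≤ L := fun i x => by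
    simpa [hb1] using (fderiv ℝ G x).le_of_opNorm_le (hL x) (b i)
  have hφ'int : ∀ i, Integrable fun x => φ' i x * exp (-f x) := fun i => by
    refine hL.integrable_mul_exp_neg hf hs (hφ'c i) (C := (1 + 2 * k) * L) (n := 2 * k)
      (by positivity) fun x => ?_
    have e1 : |(‖G x‖ ^ 2) ^ k * ⟪b i, fderiv ℝ G x (b i)⟫| ≤ ‖G x‖ ^ (2 * k) * L := by
      rw [abs_mul, abs_of_nonneg (by positivity), pow_mul]
      gcongr
      refine (abs_real_inner_le_norm _ _).trans ?_
      rw [hb1, one_mul]; exact hHb i x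
    have e2 : |k * (‖G x‖ ^ 2) ^ (k - 1) * (2 * ⟪G x, fderiv ℝ G x (b i)⟫) * ⟪b i, G x⟫|
        ≤ 2 * k * L * ‖G x‖ ^ (2 * k) := by
      rcases k with _ | k
      · simp
      rw [abs_mul, abs_mul, abs_mul, abs_mul 2, abs_two, Nat.abs_cast,
        abs_of_nonneg (by positivity : 0 ≤ (‖G x‖ ^ 2) ^ (k + 1 - 1))]
      calc _ ≤ ((k + 1 : ℕ) : ℝ) * (‖G x‖ ^ 2) ^ k * (2 * (‖G x‖ * L)) * ‖G x‖ := by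
            rw [Nat.add_sub_cancel]
            gcongr
            · exact (abs_real_inner_le_norm _ _).trans (by gcongr; exact hHb i x)
            · exact hbG i x
        _ = _ := by rw [pow_mul]; ring
    refine (abs_add_le _ _).trans ?_
    linarith
  have hφint : ∀ i, Integrable fun x => φ i x * exp (-f x) := fun i => by
    refine hL.integrable_mul_exp_neg hf hs (hφc i) (C := 1) (n := 2 * k + 1) zero_le_one
      fun x => ?_
    rw [abs_mul, abs_of_nonneg (by positivity), pow_succ _ (2 * k), pow_mul, one_mul]
    gcongr
    exact hbG i x
  have hsq : ∀ i, Integrable fun x => φ i x * ⟪G x, b i⟫ * exp (-f x) := fun i => by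
    refine hL.integrable_mul_exp_neg hf hs (by fun_prop) (C := 1) (n := 2 * k + 1 + 1) zero_le_one
      fun x => ?_
    rw [abs_mul, abs_mul, abs_of_nonneg (by positivity), pow_succ _ (2 * k + 1),
      pow_succ _ (2 * k), pow_mul, one_mul, real_inner_comm (b i)]
    gcongr ?_ * ?_ * ?_
    exacts [hbG i x, hbG i x]
  have hibp : ∀ i, ∫ x, φ i x * ⟪G x, b i⟫ * exp (-f x) = ∫ x, φ' i x * exp (-f x) := by
    intro i
    have h := integral_mul_fderiv_eq_neg_fderiv_mul_of_integrable (μ := (volume : Measure (Euc d)))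
      (f := φ i) (g := fun x => exp (-f x)) (v := b i)
      (by simpa only [(hφd i _).2] using hφ'int i)
      (by
        refine (hsq i).neg.congr (Filter.Eventually.of_forall fun x => ?_)
        simp only [(hfd _ _).2, Pi.neg_apply]
        ring)
      (hφint i) (fun x _ => (hφd i x).1) (fun x _ => (hfd x 0).1)
    simp only [(hφd i _).2, (hfd _ _).2, neg_mul, mul_neg, integral_neg, neg_inj] at h
    rw [← h]
    simp only [mul_assoc]
  have hsum1 : ∀ x, ∑ i, φ i x * ⟪G x, b i⟫ * exp (-f x)
      = (‖G x‖ ^ 2) ^ (k + 1) * exp (-f x) := fun x => by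
    rw [← Finset.sum_mul, pow_succ, ← b.sum_sq_inner_right (G x), Finset.mul_sum]
    congr 1
    refine Finset.sum_congr rfl fun i _ => ?_
    rw [real_inner_comm]
    simp only [φ, b.sum_sq_inner_right (G x)]
    rw [real_inner_comm]
    ring
  have hsum2 : ∀ x, ∑ i, φ' i x
      = (‖G x‖ ^ 2) ^ k * LinearMap.trace ℝ (Euc d) (fderiv ℝ G x : Euc d →ₗ[ℝ] Euc d)
        + 2 * k * (‖G x‖ ^ 2) ^ (k - 1) * ⟪G x, fderiv ℝ G x (G x)⟫ := fun x => by
    have e : ⟪G x, fderiv ℝ G x (G x)⟫ = ∑ i, ⟪b i, G x⟫ * ⟪G x, fderiv ℝ G x (b i)⟫ := by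
      have h1 := congrArg (fun v => ⟪G x, fderiv ℝ G x v⟫) (b.sum_repr' (G x))
      simp only [map_sum, inner_sum, map_smul, inner_smul_right] at h1
      exact h1.symm
    rw [LinearMap.trace_eq_sum_inner _ b, e, Finset.mul_sum, Finset.mul_sum,
      ← Finset.sum_add_distrib]
    refine Finset.sum_congr rfl fun i _ => ?_
    simp only [φ', ContinuousLinearMap.coe_coe]
    ring
  have hle : ∀ x, ∑ i, φ' i x ≤ (Υ + 2 * k * L) * (‖G x‖ ^ 2) ^ k := fun x => by
    rw [hsum2, add_mul]
    refine add_le_add ?_ ?_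
    · rw [mul_comm]; gcongr; exact hΥ x
    · rcases k with _ | k
      · simp
      have : ⟪G x, fderiv ℝ G x (G x)⟫ ≤ L * ‖G x‖ ^ 2 := by
        refine (real_inner_le_norm _ _).trans ?_
        have := (fderiv ℝ G x).le_of_opNorm_le (hL x) (G x)
        nlinarith [norm_nonneg (G x)]
      rw [Nat.add_sub_cancel, pow_succ _ k]
      calc _ ≤ 2 * ((k + 1 : ℕ) : ℝ) * (‖G x‖ ^ 2) ^ k * (L * ‖G x‖ ^ 2) :=
            mul_le_mul_of_nonneg_left this (by positivity)
        _ = _ := by ring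
  have hkint : Integrable fun x => (‖G x‖ ^ 2) ^ k * exp (-f x) :=
    hL.integrable_mul_exp_neg hf hs (by fun_prop) (C := 1) (n := 2 * k) zero_le_one fun x => by
      rw [abs_of_nonneg (by positivity), pow_mul, one_mul]
  calc ∫ x, (‖G x‖ ^ 2) ^ (k + 1) * exp (-f x)
      = ∑ i, ∫ x, φ i x * ⟪G x, b i⟫ * exp (-f x) := by
        simp_rw [← hsum1]; exact integral_finsetSum _ fun i _ => hsq i
    _ = ∑ i, ∫ x, φ' i x * exp (-f x) := Finset.sum_congr rfl fun i _ => hibp i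
    _ = ∫ x, (∑ i, φ' i x) * exp (-f x) := by
        simp_rw [Finset.sum_mul]; exact (integral_finsetSum _ fun i _ => hφ'int i).symm
    _ ≤ ∫ x, (Υ + 2 * k * L) * ((‖G x‖ ^ 2) ^ k * exp (-f x)) := by
        refine integral_mono ?_ (hkint.const_mul _) fun x => ?_
        · simp_rw [Finset.sum_mul]; exact integrable_finsetSum _ fun i _ => hφ'int i
        · dsimp only
          rw [← mul_assoc]
          exact mul_le_mul_of_nonneg_right (hle x) (exp_pos _).le
    _ = _ := integral_const_mul _ _

lemma SubexpTail.integral_exp_neg_pos (hs : SubexpTail f) (hf : Continuous f) :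
    0 < ∫ x, exp (-f x) :=
  integral_exp_pos (by
    simpa using hs.integrable_mul_exp_neg hf (F := fun _ => 1) continuous_const (C := 1) (n := 0)
      (by simp))

lemma nonneg_of_trace_hessian_le (hf : ContDiff ℝ 2 f) (hL : LSmooth f L) (hs : SubexpTail f)
    (hΥ : ∀ x : Euc d,
      LinearMap.trace ℝ (Euc d) (fderiv ℝ (gradient f) x : Euc d →ₗ[ℝ] Euc d) ≤ Υ) :
    0 ≤ Υ := by
  have h := integral_norm_gradient_pow_succ_le hf hL hs hΥ 0
  simp only [pow_zero, one_mul, Nat.cast_zero, mul_zero, zero_mul, add_zero] at h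
  exact nonneg_of_mul_nonneg_left ((integral_nonneg fun x => by positivity).trans h)
    (hs.integral_exp_neg_pos hf.continuous)

/-- Moments of `‖∇f‖` under the probability measure proportional to `e^{-f}`. -/
theorem eLpNorm_gradient_le (hf : ContDiff ℝ 2 f) (hL : LSmooth f L) (hs : SubexpTail f)
    (hΥ : ∀ x : Euc d,
      LinearMap.trace ℝ (Euc d) (fderiv ℝ (gradient f) x : Euc d →ₗ[ℝ] Euc d) ≤ Υ)
    {ℓ : ℕ} (hℓ : 1 ≤ ℓ) :
    eLpNorm (gradient f) ((2 * ℓ : ℕ) : ℝ≥0∞) (targetMeasure f)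
      ≤ ENNReal.ofReal (√(Υ + 2 * ((ℓ : ℝ) - 1) * L)) := by
  have hL0 := hL.nonneg
  have hΥ0 := nonneg_of_trace_hessian_le hf hL hs hΥ
  have hℓ' : (1 : ℝ) ≤ ℓ := by exact_mod_cast hℓ
  set U := Υ + 2 * ((ℓ : ℝ) - 1) * L with hU
  have hU0 : 0 ≤ U := by
    have : 0 ≤ 2 * ((ℓ : ℝ) - 1) * L := mul_nonneg (by linarith) hL0
    linarith
  have hG : Continuous (gradient f) := (contDiff_gradient (n := 1) hf).continuous
  have hmom : ∀ k ≤ ℓ, ∫ x, (‖gradient f x‖ ^ 2) ^ k * exp (-f x)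
      ≤ U ^ k * ∫ x, exp (-f x) := by
    intro k
    induction k with
    | zero => simp
    | succ k ih =>
      intro hk
      have hk' : (k : ℝ) ≤ ℓ - 1 := by
        have : ((k + 1 : ℕ) : ℝ) ≤ ℓ := by exact_mod_cast hk
        push_cast at this; linarith
      calc _ ≤ (Υ + 2 * k * L) * ∫ x, (‖gradient f x‖ ^ 2) ^ k * exp (-f x) :=
            integral_norm_gradient_pow_succ_le hf hL hs hΥ k
        _ ≤ U * (U ^ k * ∫ x, exp (-f x)) := by
            refine mul_le_mul ?_ (ih (by omega)) (integral_nonneg fun x => by positivity) hU0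
            rw [hU]; gcongr
        _ = _ := by ring
  have hint1 : Integrable fun x => exp (-f x) := by
    simpa using hs.integrable_mul_exp_neg hf.continuous (F := fun _ => 1) continuous_const
      (C := 1) (n := 0) (by simp)
  have hint : Integrable fun x => (‖gradient f x‖ ^ 2) ^ ℓ * exp (-f x) :=
    hL.integrable_mul_exp_neg hf hs (by fun_prop) (C := 1) (n := 2 * ℓ) zero_le_one fun x => by
      rw [abs_of_nonneg (by positivity), pow_mul, one_mul]
  have hmeas : Measurable fun x => ENNReal.ofReal (exp (-f x)) := by
    have := hf.continuous.measurable
    fun_prop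
  have hZ : (volume.withDensity fun x => ENNReal.ofReal (exp (-f x))) Set.univ
      = ENNReal.ofReal (∫ x, exp (-f x)) := by
    rw [withDensity_apply _ MeasurableSet.univ, setLIntegral_univ,
      ofReal_integral_eq_lintegral_ofReal hint1
        (Filter.Eventually.of_forall fun x => (exp_pos _).le)]
  apply eLpNorm_two_mul_nat_le hℓ
  rw [targetMeasure, lintegral_smul_measure, hZ,
    lintegral_withDensity_eq_lintegral_mul _ hmeas (by fun_prop), smul_eq_mul]
  have e : ∀ x, ((fun x => ENNReal.ofReal (exp (-f x))) * fun x => ‖gradient f x‖ₑ ^ (2 * ℓ)) x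
      = ENNReal.ofReal ((‖gradient f x‖ ^ 2) ^ ℓ * exp (-f x)) := fun x => by
    rw [ENNReal.ofReal_mul (by positivity), ← pow_mul, ENNReal.ofReal_pow (norm_nonneg _),
      ofReal_norm, mul_comm]
    rfl
  simp_rw [e]
  rw [← ofReal_integral_eq_lintegral_ofReal hint
    (Filter.Eventually.of_forall fun x => by positivity)]
  calc _ ≤ (ENNReal.ofReal (∫ x, exp (-f x)))⁻¹
          * (ENNReal.ofReal (U ^ ℓ) * ENNReal.ofReal (∫ x, exp (-f x))) := by
        rw [← ENNReal.ofReal_mul (by positivity)]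
        gcongr
        exact hmom ℓ le_rfl
    _ = ENNReal.ofReal (U ^ ℓ)
          * ((ENNReal.ofReal (∫ x, exp (-f x)))⁻¹ * ENNReal.ofReal (∫ x, exp (-f x))) := by ring
    _ ≤ ENNReal.ofReal (U ^ ℓ) * 1 := by gcongr; exact ENNReal.inv_mul_le_one _
    _ = _ := by
        rw [mul_one, ← ENNReal.ofReal_pow (sqrt_nonneg _), pow_mul, sq_sqrt hU0]

end GradientMoments

section ThirdDerivative

variable {d : ℕ} {f : Euc d → ℝ} {L : ℝ}

lemma inner_fderiv_gradient (hf : ContDiff ℝ 2 f) (x u v : Euc d) :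
    ⟪fderiv ℝ (gradient f) x u, v⟫ = fderiv ℝ (fderiv ℝ f) x u v := by
  have hG := ((contDiff_gradient (n := 1) hf).differentiable (by simp) x).hasFDerivAt
  have hD := ((hf.fderiv_right (m := 1) (by norm_num)).differentiable (by simp) x).hasFDerivAt
  have h1 := hG.inner ℝ (hasFDerivAt_const v x)
  have h2 := hD.clm_apply (hasFDerivAt_const v x)
  have h3 : (fun y => ⟪gradient f y, v⟫) = fun y => fderiv ℝ f y v :=
    funext fun y => inner_gradient_left
  rw [h3] at h1
  simpa [fderivInnerCLM_apply] using congrArg (fun T => T u) (h1.unique h2)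

lemma fderiv_fderiv_comm (hf : ContDiff ℝ 2 f) (x u v : Euc d) :
    fderiv ℝ (fderiv ℝ f) x u v = fderiv ℝ (fderiv ℝ f) x v u :=
  (hf.contDiffAt.isSymmSndFDerivAt (by simp)) u v

lemma iteratedFDeriv_three_apply (x : Euc d) (m : Fin 3 → Euc d) :
    iteratedFDeriv ℝ 3 f x m
      = fderiv ℝ (fderiv ℝ (fderiv ℝ f)) x (m 0) (m 1) (m 2) := by
  rw [iteratedFDeriv_succ_apply_right, iteratedFDeriv_two_apply]
  rfl

lemma tensor3_apply (x : Euc d) (i j k : Fin d) :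
    tensor3 f x i j k = fderiv ℝ (fderiv ℝ (fderiv ℝ f)) x (EuclideanSpace.single i 1)
      (EuclideanSpace.single j 1) (EuclideanSpace.single k 1) :=
  iteratedFDeriv_three_apply x _

lemma tensor3_swap_left (hf : ContDiff ℝ 3 f) (x : Euc d) (i j k : Fin d) :
    tensor3 f x i j k = tensor3 f x j i k := by
  have h := (hf.fderiv_right (m := 2) (by norm_num)).contDiffAt.isSymmSndFDerivAt (x := x) (by simp)
  rw [tensor3_apply, tensor3_apply, h]

lemma tensor3_swap_right (hf : ContDiff ℝ 3 f) (x : Euc d) (i j k : Fin d) :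
    tensor3 f x i j k = tensor3 f x i k j := by
  have hD : HasFDerivAt (fderiv ℝ (fderiv ℝ f)) (fderiv ℝ (fderiv ℝ (fderiv ℝ f)) x) x :=
    (((hf.fderiv_right (m := 2) (by norm_num)).fderiv_right (m := 1) (by norm_num)).differentiable
      (by simp) x).hasFDerivAt
  have key : ∀ v w : Euc d, HasFDerivAt (fun y => fderiv ℝ (fderiv ℝ f) y v w)
      (((fderiv ℝ (fderiv ℝ (fderiv ℝ f)) x).flip v).flip w) x := fun v w => by
    have := (hD.clm_apply (hasFDerivAt_const v x)).clm_apply (hasFDerivAt_const w x)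
    refine this.congr_fderiv ?_
    ext u; simp
  have h1 := key (EuclideanSpace.single j 1) (EuclideanSpace.single k 1)
  have h2 := key (EuclideanSpace.single k 1) (EuclideanSpace.single j 1)
  simp_rw [fderiv_fderiv_comm (hf.of_le (by norm_num)) _ (EuclideanSpace.single j 1)] at h1
  rw [tensor3_apply, tensor3_apply]
  simpa using congrArg (fun T => T (EuclideanSpace.single i 1)) (h1.unique h2)

lemma trilin_tensor3 (x u v w : Euc d) :
    trilin (tensor3 f x) u v w = fderiv ℝ (fderiv ℝ (fderiv ℝ f)) x u v w := by
  have e : ∀ y : Euc d, y = ∑ i, y i • EuclideanSpace.single i (1 : ℝ) := fun y => by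
    simpa using ((EuclideanSpace.basisFun (Fin d) ℝ).sum_repr y).symm
  conv_rhs => rw [e u, e v, e w]
  simp only [map_sum, map_smul, FunLike.coe_sum, Finset.sum_apply, smul_apply,
    smul_eq_mul, trilin, tensor3_apply, Finset.mul_sum, Finset.sum_mul]
  refine Finset.sum_congr rfl fun k _ => Finset.sum_congr rfl fun j _ =>
    Finset.sum_congr rfl fun i _ => by ring

variable {Q P : Euc d × Euc d → ℝ → Euc d}

/-- The time derivative of `⟪p, ∇²f(q) p⟫` along the Hamiltonian vector field. -/
noncomputable def hessRate (f : Euc d → ℝ) (z : Euc d × Euc d) : ℝ :=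
  trilin (tensor3 f z.1) z.2 z.2 z.2 - ⟪(2 : ℝ) • fderiv ℝ (gradient f) z.1 (gradient f z.1), z.2⟫

lemma continuous_hessRate (hf : ContDiff ℝ 3 f) : Continuous (hessRate f) := by
  have h3 : Continuous (fderiv ℝ (fderiv ℝ (fderiv ℝ f))) :=
    ((hf.fderiv_right (m := 2) (by norm_num)).fderiv_right (m := 1) (by norm_num)).continuous_fderiv
      (by simp)
  have h2 : ContDiff ℝ 1 (gradient f) := contDiff_gradient (n := 1) (hf.of_le (by norm_num))
  have h1 := h2.continuous_fderiv (by simp)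
  have h0 := h2.continuous
  unfold hessRate
  simp_rw [trilin_tensor3]
  fun_prop

lemma hasDerivAt_hessian_form (hf : ContDiff ℝ 3 f) (hQ : ∀ z s, HasDerivAt (Q z) (P z s) s)
    (hP : ∀ z s, HasDerivAt (P z) (-(gradient f (Q z s))) s) (z : Euc d × Euc d) (s : ℝ) :
    HasDerivAt (fun s => ⟪P z s, fderiv ℝ (gradient f) (Q z s) (P z s)⟫)
      (hessRate f (Q z s, P z s)) s := by
  have hf2 : ContDiff ℝ 2 f := hf.of_le (by norm_num)
  have e : (fun s => ⟪P z s, fderiv ℝ (gradient f) (Q z s) (P z s)⟫)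
      = fun s => fderiv ℝ (fderiv ℝ f) (Q z s) (P z s) (P z s) := funext fun s => by
    rw [real_inner_comm, inner_fderiv_gradient hf2]
  have hD := (((hf.fderiv_right (m := 2) (by norm_num)).fderiv_right (m := 1)
    (by norm_num)).differentiable (by simp) (Q z s)).hasFDerivAt.comp_hasDerivAt s (hQ z s)
  rw [e]
  refine ((hD.clm_apply (hP z s)).clm_apply (hP z s)).congr_deriv ?_
  simp only [hessRate, trilin_tensor3, real_inner_smul_left, inner_fderiv_gradient hf2]
  simp [fderiv_fderiv_comm hf2 (Q z s) (P z s)]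
  ring

end ThirdDerivative

section MomentBounds

lemma eLpNorm_le_of_forall_enorm_le {Ω E : Type*} [MeasurableSpace Ω] [ENorm E] {μ : Measure Ω}
    [IsProbabilityMeasure μ] {r : ℝ≥0∞} {g : Ω → E} {C : ℝ≥0∞} (hr : r ≠ 0)
    (h : ∀ x, ‖g x‖ₑ ≤ C) : eLpNorm g r μ ≤ C := by
  refine (eLpNorm_mono_enorm (g := fun _ => C) (by simpa using h)).trans ?_
  rw [eLpNorm_const _ hr (NeZero.ne μ)]
  simp

/-- Increments along the orbits of measure-preserving maps, bounded by the rate of change. -/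
lemma eLpNorm_sub_le_of_measurePreserving {Ω : Type*} [MeasurableSpace Ω] {μ : Measure Ω}
    [SFinite μ] {Φ : ℝ → Ω → Ω} (hΦ : ∀ s, MeasurePreserving (Φ s) μ μ)
    (hΦm : Measurable fun p : ℝ × Ω => Φ p.1 p.2) {φ : Ω → ℝ} (hφ : Measurable φ) {h : ℝ → Ω → ℝ}
    (hd : ∀ z s, HasDerivAt (fun s => h s z) (φ (Φ s z)) s)
    (hc : ∀ z, Continuous fun s => φ (Φ s z)) {t : ℝ} (ht : 0 ≤ t) {r : ℝ≥0∞} (hr : 1 ≤ r)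
    (hr' : r ≠ ⊤) :
    eLpNorm (fun z => h t z - h 0 z) r μ ≤ ENNReal.ofReal t * eLpNorm φ r μ := by
  have h0 : r ≠ 0 := (zero_lt_one.trans_le hr).ne'
  have hr1 : 1 ≤ r.toReal := by simpa using ENNReal.toReal_mono hr' hr
  set ν : Measure ℝ := volume.restrict (Set.Ioc 0 t) with hν
  have hνuniv : ν Set.univ = ENNReal.ofReal t := by simp [hν]
  set c : ℝ≥0 := (t ^ (1 - 1 / r.toReal)).toNNReal with hc'
  have hpt : ∀ z, ‖h t z - h 0 z‖ₑ
      ≤ c * ‖eLpNorm (fun s => φ (Φ s z)) r ν‖ₑ := by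
    intro z
    rw [← intervalIntegral.integral_eq_sub_of_hasDerivAt (fun s _ => hd z s)
      ((hc z).intervalIntegrable _ _), intervalIntegral.integral_of_le ht]
    refine (enorm_integral_le_lintegral_enorm _).trans ?_
    rw [← eLpNorm_one_eq_lintegral_enorm, enorm_eq_self, mul_comm]
    refine (eLpNorm_le_eLpNorm_mul_rpow_measure_univ hr
      (hc z).measurable.aestronglyMeasurable).trans ?_
    rw [hνuniv, ENNReal.toReal_one, div_one, ENNReal.ofReal_rpow_of_nonneg ht]
    · rfl
    rw [sub_nonneg, div_le_one (by linarith)]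
    exact hr1
  have hm1 : Measurable fun p : Ω × ℝ => φ (Φ p.2 p.1) := hφ.comp (hΦm.comp measurable_swap)
  have hm2 : Measurable fun p : ℝ × Ω => φ (Φ p.1 p.2) := hφ.comp hΦm
  have hswap : eLpNorm (fun p : Ω × ℝ => φ (Φ p.2 p.1)) r (μ.prod ν)
      = eLpNorm (fun p : ℝ × Ω => φ (Φ p.1 p.2)) r (ν.prod μ) := by
    have hsw : MeasurePreserving Prod.swap (μ.prod ν) (ν.prod μ) := Measure.measurePreserving_swap
    have := eLpNorm_comp_measurePreserving (p := r) hm2.aestronglyMeasurable hsw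
    simpa only [Function.comp_def, Prod.fst_swap, Prod.snd_swap] using this
  have hinv : ∀ s, eLpNorm (fun z => φ (Φ s z)) r μ = eLpNorm φ r μ := fun s => by
    have := eLpNorm_comp_measurePreserving (p := r) hφ.aestronglyMeasurable (hΦ s)
    simpa only [Function.comp_def] using this
  calc eLpNorm (fun z => h t z - h 0 z) r μ
      ≤ c
          * eLpNorm (fun z => eLpNorm (fun s => φ (Φ s z)) r ν) r μ :=
        eLpNorm_le_nnreal_smul_eLpNorm_of_ae_le_mul' (c := c) (Filter.Eventually.of_forall hpt) r
    _ = c * eLpNorm (fun _ : ℝ => eLpNorm φ r μ) r ν := by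
        rw [← eLpNorm_prod_eq h0 hr' hm1, hswap, eLpNorm_prod_eq h0 hr' hm2]
        simp_rw [hinv]
    _ = ENNReal.ofReal t * eLpNorm φ r μ := by
        rcases ht.eq_or_lt with rfl | ht
        · simp [hν]
        · rw [eLpNorm_const' _ h0 hr', hνuniv, enorm_eq_self,
            ENNReal.ofReal_rpow_of_pos ht, hc', ← ENNReal.ofReal, mul_left_comm,
            ← ENNReal.ofReal_mul (by positivity),
            ← rpow_add ht, sub_add_cancel, rpow_one, mul_comm]

variable {d : ℕ} {f : Euc d → ℝ} {L Υ J123 J12_3 : ℝ}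

/-- Moments of the rate of change of `⟪p, ∇²f(q) p⟫` in stationarity. -/
lemma eLpNorm_hessRate_le (hf : ContDiff ℝ 3 f) (hL : LSmooth f L) (hs : SubexpTail f)
    [IsProbabilityMeasure (targetMeasure f)]
    (hΥ : ∀ x : Euc d,
      LinearMap.trace ℝ (Euc d) (fderiv ℝ (gradient f) x : Euc d →ₗ[ℝ] Euc d) ≤ Υ)
    (h123 : ∀ x, norm123 (tensor3 f x) ≤ J123) (h12_3 : ∀ x, norm12_3 (tensor3 f x) ≤ J12_3)
    {ℓ : ℕ} (hℓ : 1 ≤ ℓ) :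
    eLpNorm (hessRate f) ((2 * ℓ : ℕ) : ℝ≥0∞) ((targetMeasure f).prod (stdGaussian d))
      ≤ 8 * (2 * (ENNReal.ofReal (5 * √ℓ) ^ 3 * ENNReal.ofReal J123)
          + ENNReal.ofReal (5 * √ℓ) * ENNReal.ofReal (√d * J12_3))
        + ENNReal.ofReal (5 * √ℓ)
          * ENNReal.ofReal (2 * L * √(Υ + 2 * ((ℓ : ℝ) - 1) * L)) := by
  have hf2 : ContDiff ℝ 2 f := hf.of_le (by norm_num)
  have hL0 := hL.nonneg
  have hr0 : ((2 * ℓ : ℕ) : ℝ≥0∞) ≠ 0 := by exact_mod_cast (by omega : 2 * ℓ ≠ 0)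
  have hr1 : (1 : ℝ≥0∞) ≤ ((2 * ℓ : ℕ) : ℝ≥0∞) := by exact_mod_cast (by omega : 1 ≤ 2 * ℓ)
  set r := ((2 * ℓ : ℕ) : ℝ≥0∞) with hr
  have hrt : r ≠ ⊤ := ENNReal.natCast_ne_top _
  let w : Euc d → Euc d := fun q => (2 : ℝ) • fderiv ℝ (gradient f) q (gradient f q)
  have hG : ContDiff ℝ 1 (gradient f) := contDiff_gradient (n := 1) hf2
  have hwc : Continuous w := by
    have h1 := hG.continuous_fderiv (by simp)
    have h0 := hG.continuous
    fun_prop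
  have hcub : Continuous fun z : Euc d × Euc d => trilin (tensor3 f z.1) z.2 z.2 z.2 := by
    have : (fun z : Euc d × Euc d => trilin (tensor3 f z.1) z.2 z.2 z.2)
        = fun z => hessRate f z + ⟪w z.1, z.2⟫ := funext fun z => by simp [hessRate, w]
    rw [this]
    exact (continuous_hessRate hf).add (by fun_prop)
  have hw : eLpNorm w r (targetMeasure f)
      ≤ ENNReal.ofReal (2 * L * √(Υ + 2 * ((ℓ : ℝ) - 1) * L)) := by
    rw [ENNReal.ofReal_mul (by positivity)]
    refine (eLpNorm_le_mul_eLpNorm_of_ae_le_mul (c := 2 * L) (g := gradient f)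
      (Filter.Eventually.of_forall fun q => ?_) r).trans ?_
    · have := (fderiv ℝ (gradient f) q).le_of_opNorm_le (hL q) (gradient f q)
      simp only [w, norm_smul, norm_ofNat]
      linarith
    · gcongr
      exact eLpNorm_gradient_le hf2 hL hs hΥ hℓ
  refine (eLpNorm_sub_le (f := fun z : Euc d × Euc d => trilin (tensor3 f z.1) z.2 z.2 z.2)
    (g := fun z => ⟪w z.1, z.2⟫) hcub.aestronglyMeasurable
    (by fun_prop : Continuous fun z : Euc d × Euc d => ⟪w z.1, z.2⟫).aestronglyMeasurable
    hr1).trans (add_le_add ?_ ?_)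
  · rw [eLpNorm_prod_eq hr0 hrt hcub.measurable]
    refine eLpNorm_le_of_forall_enorm_le hr0 fun q => ?_
    rw [enorm_eq_self]
    refine (eLpNorm_cubic_le hℓ (tensor3_swap_left hf q) (tensor3_swap_right hf q)).trans ?_
    gcongr
    · exact h123 q
    · rw [← ofReal_norm]
      refine ENNReal.ofReal_le_ofReal ((norm_contract12_le _).trans ?_)
      gcongr
      exact h12_3 q
  · exact (eLpNorm_inner_prod_stdGaussian_le ℓ hℓ hwc.measurable).trans (by gcongr)

end MomentBounds

/-- **Lemma (stability of the quadratic form `𝔭ᵀ∇²f_𝔮 𝔭` along Hamiltonian dynamics).** -/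
theorem hamiltonian_quadratic_form_stability :
    ∃ c : ℝ, 0 < c ∧
    ∀ (d : ℕ) (f : Euc d → ℝ) (L Υ J123 J12_3 t : ℝ) (ℓ : ℕ)
      (Q P : Euc d × Euc d → ℝ → Euc d),
      ContDiff ℝ 3 f → LSmooth f L → SubexpTail f →
      IsProbabilityMeasure (targetMeasure f) →
      (∀ x : Euc d,
        LinearMap.trace ℝ (Euc d) (fderiv ℝ (gradient f) x : Euc d →ₗ[ℝ] Euc d) ≤ Υ) →
      (∀ x : Euc d, norm123 (tensor3 f x) ≤ J123) →
      (∀ x : Euc d, norm12_3 (tensor3 f x) ≤ J12_3) →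
      1 ≤ ℓ → 0 ≤ t →
      (∀ z : Euc d × Euc d, Q z 0 = z.1) →
      (∀ z : Euc d × Euc d, P z 0 = z.2) →
      (∀ (z : Euc d × Euc d) (s : ℝ), HasDerivAt (Q z) (P z s) s) →
      (∀ (z : Euc d × Euc d) (s : ℝ), HasDerivAt (P z) (-(gradient f (Q z s))) s) →
      (∫⁻ z : Euc d × Euc d,
          ENNReal.ofReal
            (|⟪P z t, fderiv ℝ (gradient f) (Q z t) (P z t)⟫
              - ⟪z.2, fderiv ℝ (gradient f) z.1 z.2⟫| ^ ℓ)
          ∂((targetMeasure f).prod (stdGaussian d))) ^ ((ℓ : ℝ)⁻¹)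
        ≤ ENNReal.ofReal (c * t *
            ((ℓ : ℝ) ^ ((1:ℝ)/2) * L * (Υ + 2 * ((ℓ : ℝ) - 1) * L) ^ ((1:ℝ)/2)
              + (ℓ : ℝ) ^ ((3:ℝ)/2) * J123
              + (ℓ : ℝ) ^ ((1:ℝ)/2) * (d : ℝ) ^ ((1:ℝ)/2) * J12_3)) := by
  refine ⟨2000, by norm_num, ?_⟩
  intro d f L Υ J123 J12_3 t ℓ Q P hf hL hs hprob hΥ h123 h12_3 hℓ ht hQ0 hP0 hQ hP
  have hf2 : ContDiff ℝ 2 f := hf.of_le (by norm_num)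
  have hL0 := hL.nonneg
  have hJ123 : 0 ≤ J123 := (norm123_nonneg _).trans (h123 0)
  have hJ12_3 : 0 ≤ J12_3 := (norm12_3_nonneg _).trans (h12_3 0)
  have hflow := isGlobalFlow_hamField hQ0 hP0 hQ hP
  have hΦ := measurePreserving_hamiltonian_flow hf2 hL hQ0 hP0 hQ hP
  have hG : ContDiff ℝ 1 (gradient f) := contDiff_gradient (n := 1) hf2
  have hH : Continuous (fderiv ℝ (gradient f)) := hG.continuous_fderiv (by simp)
  have hrate := continuous_hessRate hf
  have hjoint : Continuous fun p : ℝ × (Euc d × Euc d) => (Q p.2 p.1, P p.2 p.1) :=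
    hflow.continuous_uncurry (hL.lipschitzWith_hamField hf2)
  have hform : Continuous fun z : Euc d × Euc d => ⟪z.2, fderiv ℝ (gradient f) z.1 z.2⟫ := by
    fun_prop
  have hincr := eLpNorm_sub_le_of_measurePreserving (h := fun s z =>
      ⟪P z s, fderiv ℝ (gradient f) (Q z s) (P z s)⟫) hΦ hjoint.measurable hrate.measurable
    (hasDerivAt_hessian_form hf hQ hP)
    (fun z => hrate.comp (hjoint.comp (continuous_id.prodMk continuous_const))) ht
    (r := ((2 * ℓ : ℕ) : ℝ≥0∞)) (by exact_mod_cast (by omega : 1 ≤ 2 * ℓ))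
    (ENNReal.natCast_ne_top _)
  simp only [hQ0, hP0] at hincr
  set g : Euc d × Euc d → ℝ := fun z => ⟪P z t, fderiv ℝ (gradient f) (Q z t) (P z t)⟫
    - ⟪z.2, fderiv ℝ (gradient f) z.1 z.2⟫ with hg
  have hgm : Measurable g := (hform.measurable.comp (hΦ t).measurable).sub hform.measurable
  have hlhs : (∫⁻ z, ENNReal.ofReal (|g z| ^ ℓ) ∂((targetMeasure f).prod (stdGaussian d)))
      ^ ((ℓ : ℝ)⁻¹) = eLpNorm g (ℓ : ℝ≥0∞) ((targetMeasure f).prod (stdGaussian d)) := by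
    rw [eLpNorm_eq_lintegral_rpow_enorm_toReal (by exact_mod_cast (by omega : ℓ ≠ 0))
      (ENNReal.natCast_ne_top _)]
    simp only [ENNReal.toReal_natCast, ENNReal.rpow_natCast, one_div,
      ENNReal.ofReal_pow (norm_nonneg _), ← Real.norm_eq_abs, ofReal_norm]
  calc _ = eLpNorm g (ℓ : ℝ≥0∞) ((targetMeasure f).prod (stdGaussian d)) := hlhs
    _ ≤ eLpNorm g ((2 * ℓ : ℕ) : ℝ≥0∞) ((targetMeasure f).prod (stdGaussian d)) :=
        eLpNorm_le_eLpNorm_of_exponent_le (by exact_mod_cast (by omega : ℓ ≤ 2 * ℓ))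
          hgm.aestronglyMeasurable
    _ ≤ ENNReal.ofReal t
          * (8 * (2 * (ENNReal.ofReal (5 * √ℓ) ^ 3 * ENNReal.ofReal J123)
            + ENNReal.ofReal (5 * √ℓ) * ENNReal.ofReal (√d * J12_3))
          + ENNReal.ofReal (5 * √ℓ)
            * ENNReal.ofReal (2 * L * √(Υ + 2 * ((ℓ : ℝ) - 1) * L))) :=
        hincr.trans (by gcongr; exact eLpNorm_hessRate_le hf hL hs hΥ h123 h12_3 hℓ)
    _ = ENNReal.ofReal (t * (8 * (2 * ((5 * √ℓ) ^ 3 * J123) + 5 * √ℓ * (√d * J12_3))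
          + 5 * √ℓ * (2 * L * √(Υ + 2 * ((ℓ : ℝ) - 1) * L)))) := by
        have ha : 0 ≤ 5 * √(ℓ : ℝ) := by positivity
        have hb : 0 ≤ √(d : ℝ) * J12_3 := by positivity
        have he : 0 ≤ 2 * L * √(Υ + 2 * ((ℓ : ℝ) - 1) * L) := by positivity
        generalize 5 * √(ℓ : ℝ) = a at ha ⊢
        generalize √(d : ℝ) * J12_3 = b at hb ⊢
        generalize 2 * L * √(Υ + 2 * ((ℓ : ℝ) - 1) * L) = e at he ⊢
        rw [ENNReal.ofReal_mul ht, ENNReal.ofReal_add (by positivity) (by positivity),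
          ENNReal.ofReal_mul (p := 8) (by norm_num),
          ENNReal.ofReal_add (by positivity) (by positivity),
          ENNReal.ofReal_mul (p := 2) (by norm_num), ENNReal.ofReal_mul (by positivity),
          ENNReal.ofReal_pow ha, ENNReal.ofReal_mul ha, ENNReal.ofReal_mul ha,
          ENNReal.ofReal_ofNat, ENNReal.ofReal_ofNat]
    _ ≤ _ := by
        refine ENNReal.ofReal_le_ofReal ?_
        have e3 : (ℓ : ℝ) ^ ((3 : ℝ) / 2) = √ℓ ^ 3 := by
          rw [sqrt_eq_rpow, ← rpow_natCast, ← rpow_mul (by positivity)]; norm_num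
        rw [e3, ← sqrt_eq_rpow, ← sqrt_eq_rpow, ← sqrt_eq_rpow]
        have h1 : 0 ≤ √ℓ * L * √(Υ + 2 * ((ℓ : ℝ) - 1) * L) := by positivity
        have h2 : 0 ≤ √ℓ * √d * J12_3 := by positivity
        rw [mul_comm 2000 t, mul_assoc t]
        refine mul_le_mul_of_nonneg_left ?_ ht
        nlinarith
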